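/- arXiv:math/0209252 — 2 statements merged into one kernel-verified Lean document; each statement's English description precedes it below -/
import Mathlib

section
/- Let S be a semigroup having an embeddable *-pair P = (≤_l, ≤_r). Then there exists a completely regular semigroup Q containing S as a subsemigroup such that S is a straight left order in Q and Q induces P, if and only if P satisfies conditions (GI) and (Gii), where (GI) is the condition G(S) = S. -/
universe u

variable {Q : Type u}

/-- `p ≤_L q` in a semigroup `Q`: `Q¹p ⊆ Q¹q`, i.e. `p = q` or `p = x*q` for some `x`. -/
def leL [Semigroup Q] (p q : Q) : Prop := p = q ∨ ∃ x, p = x * q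

/-- `p ≤_R q` in a semigroup `Q`: `pQ¹ ⊆ qQ¹`. -/
def leR [Semigroup Q] (p q : Q) : Prop := p = q ∨ ∃ x, p = q * x

/-- Green's relation `L`. -/
def GreenL [Semigroup Q] (p q : Q) : Prop := leL p q ∧ leL q p

/-- Green's relation `R`. -/
def GreenR [Semigroup Q] (p q : Q) : Prop := leR p q ∧ leR q p

/-- Green's relation `H = L ∩ R`. -/
def GreenH [Semigroup Q] (p q : Q) : Prop := GreenL p q ∧ GreenR p q

/-- Green's relation `D = L ∘ R`. -/
def GreenD [Semigroup Q] (p q : Q) : Prop := ∃ c, GreenL p c ∧ GreenR c q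

/-- `h` is the group inverse `q♯` of `q` (in the group `H`-class of `q`):
`q` and `h` commute, `qhq = q` and `hqh = h`.  This holds precisely when `q` lies in a
subgroup of `Q` and `h` is its group inverse there. -/
def IsGroupInverse [Semigroup Q] (q h : Q) : Prop :=
  q * h = h * q ∧ q * h * q = q ∧ h * q * h = h

/-- `q` lies in a subgroup of `Q` (i.e. `q ∈ H(Q)`, the `H`-class of `q` is a group). -/
def inSubgroup [Semigroup Q] (q : Q) : Prop := ∃ h, IsGroupInverse q h

/-- A semigroup is regular if every element `q` can be written `q = qxq`. -/
def Regular (Q : Type u) [Semigroup Q] : Prop := ∀ q : Q, ∃ x, q * x * q = q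

variable {S : Type u}

/-- `a ≤_{L*} b` in a semigroup `S`: for all `x, y ∈ S¹`, `bx = by` implies `ax = ay`. -/
def leLstar [Semigroup S] (a b : S) : Prop :=
  ∀ x y : WithOne S, (b : WithOne S) * x = (b : WithOne S) * y →
    (a : WithOne S) * x = (a : WithOne S) * y

/-- `a ≤_{R*} b` in a semigroup `S`: for all `x, y ∈ S¹`, `xb = yb` implies `xa = ya`. -/
def leRstar [Semigroup S] (a b : S) : Prop :=
  ∀ x y : WithOne S, x * (b : WithOne S) = y * (b : WithOne S) →
    x * (a : WithOne S) = y * (a : WithOne S)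

/-- `a` is square cancellable: `a H* a²`, i.e. `a L* a²` and `a R* a²`. -/
def SqC [Semigroup S] (a : S) : Prop :=
  leLstar a (a * a) ∧ leLstar (a * a) a ∧ leRstar a (a * a) ∧ leRstar (a * a) a

/-- `S(S)`, the set of square cancellable elements of `S`. -/
def SqSet (S : Type u) [Semigroup S] : Set S := { a | SqC a }

/-- `(lel, ler)` is a `*`-pair for `S`: both are preorders, `lel` is right compatible
with multiplication, `ler` is left compatible, `lel ⊆ ≤_{L*}` and `ler ⊆ ≤_{R*}`. -/
def IsStarPair [Semigroup S] (lel ler : S → S → Prop) : Prop :=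
  (∀ a, lel a a) ∧ (∀ a b c, lel a b → lel b c → lel a c) ∧
  (∀ a, ler a a) ∧ (∀ a b c, ler a b → ler b c → ler a c) ∧
  (∀ a b c, lel a b → lel (a * c) (b * c)) ∧
  (∀ a b c, ler a b → ler (c * a) (c * b)) ∧
  (∀ a b, lel a b → leLstar a b) ∧
  (∀ a b, ler a b → leRstar a b)

/-- The equivalence `L'` associated with `lel`. -/
def Lp [Semigroup S] (lel : S → S → Prop) (a b : S) : Prop := lel a b ∧ lel b a

/-- The equivalence `R'` associated with `ler`. -/
def Rp [Semigroup S] (ler : S → S → Prop) (a b : S) : Prop := ler a b ∧ ler b a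

/-- `H' = L' ∩ R'`. -/
def Hp [Semigroup S] (lel ler : S → S → Prop) (a b : S) : Prop :=
  Lp lel a b ∧ Rp ler a b

/-- `G(S) = { a ∈ S : a H' a² }`. -/
def GS [Semigroup S] (lel ler : S → S → Prop) : Set S := { a | Hp lel ler a (a * a) }

/-- Condition (Ei): `L' ∘ R' = R' ∘ L'`. -/
def CondEi [Semigroup S] (lel ler : S → S → Prop) : Prop :=
  ∀ a b : S, (∃ c, Lp lel a c ∧ Rp ler c b) ↔ (∃ c, Rp ler a c ∧ Lp lel c b)

/-- Condition (Eii)(l): `b ≤_l c` iff `b L' dc` for some `d ∈ S`. -/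
def CondEiiL [Semigroup S] (lel : S → S → Prop) : Prop :=
  ∀ b c : S, lel b c ↔ ∃ d, Lp lel b (d * c)

/-- Condition (Eii)(r): `b ≤_r c` iff `b R' cd` for some `d ∈ S`. -/
def CondEiiR [Semigroup S] (ler : S → S → Prop) : Prop :=
  ∀ b c : S, ler b c ↔ ∃ d, Rp ler b (c * d)

/-- Condition (Eiii): every `L'`-class and every `R'`-class contains an element of
`G(S)`. -/
def CondEiii [Semigroup S] (lel ler : S → S → Prop) : Prop :=
  (∀ a : S, ∃ g ∈ GS lel ler, Lp lel a g) ∧ (∀ a : S, ∃ g ∈ GS lel ler, Rp ler a g)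

/-- Condition (Ev)(l): for `a ∈ G(S)` and `b ∈ S`, `b ≤_l a` implies `ba R' b`. -/
def CondEvL [Semigroup S] (lel ler : S → S → Prop) : Prop :=
  ∀ a ∈ GS lel ler, ∀ b : S, lel b a → Rp ler (b * a) b

/-- Condition (Ev)(r): for `a ∈ G(S)` and `b ∈ S`, `b ≤_r a` implies `ab L' b`. -/
def CondEvR [Semigroup S] (lel ler : S → S → Prop) : Prop :=
  ∀ a ∈ GS lel ler, ∀ b : S, ler b a → Lp lel (a * b) b

/-- Condition (Evi)(l): for `a ∈ G(S)`, `b, c ≤_l a` and `ba = ca` imply `b = c`. -/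
def CondEviL [Semigroup S] (lel ler : S → S → Prop) : Prop :=
  ∀ a ∈ GS lel ler, ∀ b c : S, lel b a → lel c a → b * a = c * a → b = c

/-- Condition (Evi)(r): for `a ∈ G(S)`, `b, c ≤_r a` and `ab = ac` imply `b = c`. -/
def CondEviR [Semigroup S] (lel ler : S → S → Prop) : Prop :=
  ∀ a ∈ GS lel ler, ∀ b c : S, ler b a → ler c a → a * b = a * c → b = c

/-- Condition (Evii)(l): for `a ∈ G(S)`, `b, c ≤_l a` and `ba L' ca` imply `b L' c`. -/
def CondEviiL [Semigroup S] (lel ler : S → S → Prop) : Prop :=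
  ∀ a ∈ GS lel ler, ∀ b c : S, lel b a → lel c a → Lp lel (b * a) (c * a) → Lp lel b c

/-- Condition (Evii)(r): for `a ∈ G(S)`, `b, c ≤_r a` and `ab R' ac` imply `b R' c`. -/
def CondEviiR [Semigroup S] (lel ler : S → S → Prop) : Prop :=
  ∀ a ∈ GS lel ler, ∀ b c : S, ler b a → ler c a → Rp ler (a * b) (a * c) → Rp ler b c

/-- An embeddable `*`-pair: a `*`-pair satisfying (Ei), (Eii), (Eiii), (Ev), (Evi) and
(Evii) (left and right versions). -/
def IsEmbeddableStarPair [Semigroup S] (lel ler : S → S → Prop) : Prop :=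
  IsStarPair lel ler ∧ CondEi lel ler ∧ CondEiiL lel ∧ CondEiiR ler ∧
  CondEiii lel ler ∧ CondEvL lel ler ∧ CondEvR lel ler ∧
  CondEviL lel ler ∧ CondEviR lel ler ∧ CondEviiL lel ler ∧ CondEviiR lel ler

/-- Condition (Gi): `S(S) = G(S)`. -/
def CondGi [Semigroup S] (lel ler : S → S → Prop) : Prop := SqSet S = GS lel ler

/-- Condition (Gii): for every square cancellable `a`, the `H'`-class of `a` is right
reversible: for all `x, y H' a` there exist `u, v H' a` with `ux = vy`. -/
def CondGii [Semigroup S] (lel ler : S → S → Prop) : Prop :=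
  ∀ a ∈ SqSet S, ∀ x y : S, Hp lel ler x a → Hp lel ler y a →
    ∃ u v : S, Hp lel ler u a ∧ Hp lel ler v a ∧ u * x = v * y

/-- Condition (Gii)': for every square cancellable `a`, the `H'`-class of `a` is left
reversible: for all `x, y H' a` there exist `u, v H' a` with `xu = yv`. -/
def CondGii' [Semigroup S] (lel ler : S → S → Prop) : Prop :=
  ∀ a ∈ SqSet S, ∀ x y : S, Hp lel ler x a → Hp lel ler y a →
    ∃ u v : S, Hp lel ler u a ∧ Hp lel ler v a ∧ x * u = y * v

/-- `Q` (a semigroup) together with the injective multiplicative embedding `f` realises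
`S` as a subsemigroup of `Q` which is a straight left order in `Q`, and `Q` induces the
`*`-pair `(lel, ler)` on `S`: (a) every element of `Q` is `a♯ * b` with `a, b ∈ S` and
`a R b` in `Q`; (b) every square cancellable element of `S` lies in a subgroup of `Q`;
(c) for `b, c ∈ S`, `b ≤_l c` iff `b ≤_L c` in `Q`, and `b ≤_r c` iff `b ≤_R c` in
`Q`. -/
def StraightLeftOrderExtension [Semigroup S] (lel ler : S → S → Prop)
    (Q : Type u) [Semigroup Q] (f : S → Q) : Prop :=
  Function.Injective f ∧ (∀ a b : S, f (a * b) = f a * f b) ∧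
  (∀ q : Q, ∃ a b : S, (∃ c, IsGroupInverse (f a) c ∧ q = c * f b) ∧ GreenR (f a) (f b)) ∧
  (∀ a : S, SqC a → inSubgroup (f a)) ∧
  (∀ b c : S, (lel b c ↔ leL (f b) (f c)) ∧ (ler b c ↔ leR (f b) (f c)))

/-- As in `StraightLeftOrderExtension`, but `S` is moreover a straight right order in
`Q`: every element of `Q` is `b * a♯` with `a, b ∈ S` and `a L b` in `Q`. -/
def StraightOrderExtension [Semigroup S] (lel ler : S → S → Prop)
    (Q : Type u) [Semigroup Q] (f : S → Q) : Prop :=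
  StraightLeftOrderExtension lel ler Q f ∧
  (∀ q : Q, ∃ a b : S, (∃ c, IsGroupInverse (f a) c ∧ q = f b * c) ∧ GreenL (f a) (f b))

/-- A semigroup is completely regular if every element lies in a subgroup. -/
def CompletelyRegular (Q : Type u) [Semigroup Q] : Prop := ∀ q : Q, inSubgroup q

/-- Condition (GI): `G(S) = S`. -/
def CondGI [Semigroup S] (lel ler : S → S → Prop) : Prop := GS lel ler = Set.univ

/-! ### Green's relations and group inverses -/

theorem leL_trans [Semigroup Q] {p q r : Q} (h₁ : leL p q) (h₂ : leL q r) : leL p r := by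
  rcases h₁ with rfl | ⟨x, rfl⟩
  · exact h₂
  · rcases h₂ with rfl | ⟨y, rfl⟩
    · exact Or.inr ⟨x, rfl⟩
    · exact Or.inr ⟨x * y, (mul_assoc _ _ _).symm⟩

theorem leR_trans [Semigroup Q] {p q r : Q} (h₁ : leR p q) (h₂ : leR q r) : leR p r := by
  rcases h₁ with rfl | ⟨x, rfl⟩
  · exact h₂
  · rcases h₂ with rfl | ⟨y, rfl⟩
    · exact Or.inr ⟨x, rfl⟩
    · exact Or.inr ⟨y * x, mul_assoc _ _ _⟩

theorem leL_mul_left [Semigroup Q] (x q : Q) : leL (x * q) q := Or.inr ⟨x, rfl⟩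

theorem leR_mul_right [Semigroup Q] (q x : Q) : leR (q * x) q := Or.inr ⟨x, rfl⟩

namespace IsGroupInverse

section Semigroup

variable [Semigroup Q] {p q h k : Q}

theorem symm (H : IsGroupInverse q h) : IsGroupInverse h q := ⟨H.1.symm, H.2.2, H.2.1⟩

theorem mul_mul_cancel_of_leR (H : IsGroupInverse q h) (hp : leR p q) : q * (h * p) = p := by
  rcases hp with rfl | ⟨x, rfl⟩
  · rw [← mul_assoc, H.2.1]
  · rw [← mul_assoc, ← mul_assoc, H.2.1]

theorem mul_mul_cancel_of_leR' (H : IsGroupInverse q h) (hp : leR p q) : h * (q * p) = p := by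
  rw [← mul_assoc, ← H.1, mul_assoc, H.mul_mul_cancel_of_leR hp]

theorem mul_mul_cancel_of_leL (H : IsGroupInverse q h) (hp : leL p q) : p * (h * q) = p := by
  rcases hp with rfl | ⟨x, rfl⟩
  · rw [← mul_assoc, H.2.1]
  · rw [mul_assoc, ← mul_assoc q, H.2.1]

theorem mul_mul_cancel_of_leL' (H : IsGroupInverse q h) (hp : leL p q) : p * (q * h) = p := by
  rw [H.1, H.mul_mul_cancel_of_leL hp]

theorem leR_inv (H : IsGroupInverse q h) : leR h q :=
  Or.inr ⟨h * h, by rw [← mul_assoc, H.1, H.2.2]⟩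

theorem leL_inv (H : IsGroupInverse q h) : leL h q :=
  Or.inr ⟨h * h, by rw [mul_assoc, ← H.1, ← mul_assoc, H.2.2]⟩

/-- Group inverses are unique. -/
theorem unique (H : IsGroupInverse q h) (K : IsGroupInverse q k) : h = k := by
  have h₁ : h * (q * k) = h := K.mul_mul_cancel_of_leL' H.leL_inv
  have h₂ : h * (q * k) = k := H.mul_mul_cancel_of_leR' K.leR_inv
  exact h₁.symm.trans h₂

theorem sq (H : IsGroupInverse q h) : IsGroupInverse (q * q) (h * h) := by
  have e₁ : q * q * (h * h) = q * h := by
    rw [mul_assoc, H.mul_mul_cancel_of_leR H.leR_inv]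
  have e₂ : h * h * (q * q) = q * h := by
    rw [mul_assoc, H.symm.mul_mul_cancel_of_leR H.symm.leR_inv, H.1]
  refine ⟨e₁.trans e₂.symm, ?_, ?_⟩
  · rw [e₁, mul_assoc, H.mul_mul_cancel_of_leR (leR_mul_right q q)]
  · rw [e₂, mul_assoc, H.mul_mul_cancel_of_leR (leR_trans (leR_mul_right h h) H.leR_inv)]

end Semigroup

/-- A self-map which restricts to a bijection of its range onto itself has a group inverse. -/
theorem exists_of_end {X : Type*} (g : Function.End X) (hs : ∀ x, ∃ y, g (g y) = g x)
    (hi : ∀ x y, g (g x) = g (g y) → g x = g y) : ∃ h : Function.End X, g * h = h * g ∧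
      g * h * g = g ∧ h * g * h = h := by
  choose s hs using hs
  have e₁ : ∀ x, g (g (s (s x))) = g (s x) := fun x => hs _
  have e₂ : ∀ x, g (s (s (g x))) = g (s x) := fun x => by
    apply hi
    rw [e₁]
    apply hi
    rw [hs, hs]
  refine ⟨fun x => g (s (s x)), ?_, ?_, ?_⟩
  · funext x
    exact (e₁ x).trans (e₂ x).symm
  · funext x
    change g (g (s (s (g x)))) = g x
    rw [e₂, hs]
  · funext x
    change g (s (s (g (g (s (s x)))))) = g (s (s x))
    rw [e₂]
    apply hi
    rw [hs]

end IsGroupInverse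

/-! ### Necessity -/

theorem condGI_of_extension [Semigroup S] {lel ler : S → S → Prop} [Semigroup Q] {f : S → Q}
    (hQ : CompletelyRegular Q) (hf : StraightLeftOrderExtension lel ler Q f) :
    CondGI lel ler := by
  obtain ⟨-, hmul, -, -, hind⟩ := hf
  refine Set.eq_univ_of_forall fun a => ?_
  obtain ⟨h, H⟩ := hQ (f a)
  refine ⟨⟨(hind _ _).1.2 ?_, (hind _ _).1.2 ?_⟩, (hind _ _).2.2 ?_, (hind _ _).2.2 ?_⟩ <;>
    rw [hmul]
  · exact Or.inr ⟨h, (H.mul_mul_cancel_of_leR' (Or.inl rfl)).symm⟩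
  · exact leL_mul_left _ _
  · exact Or.inr ⟨h, by rw [mul_assoc, H.mul_mul_cancel_of_leL' (Or.inl rfl)]⟩
  · exact leR_mul_right _ _

theorem condGii_of_extension [Semigroup S] {lel ler : S → S → Prop} [Semigroup Q] {f : S → Q}
    (hQ : CompletelyRegular Q) (hf : StraightLeftOrderExtension lel ler Q f) :
    CondGii lel ler := by
  obtain ⟨hinj, hmul, hfrac, -, hind⟩ := hf
  intro a _ x y hx hy
  obtain ⟨A', hA⟩ := hQ (f a)
  obtain ⟨X', hX⟩ := hQ (f x)
  obtain ⟨Y', hY⟩ := hQ (f y)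
  have xaL := (hind _ _).1.1 hx.1.1
  have axL := (hind _ _).1.1 hx.1.2
  have xaR := (hind _ _).2.1 hx.2.1
  have axR := (hind _ _).2.1 hx.2.2
  have yaL := (hind _ _).1.1 hy.1.1
  have ayL := (hind _ _).1.1 hy.1.2
  obtain ⟨c, b, ⟨C', hC, hq⟩, cbR, bcR⟩ := hfrac (f a * (f x * Y'))
  obtain ⟨B', hB⟩ := hQ (f b)
  have hb : f b = f c * (f a * (f x * Y')) := by
    rw [hq, hC.mul_mul_cancel_of_leR bcR]
  have qcR : leR (f a * (f x * Y')) (f c) := by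
    rw [hq]
    exact leR_trans (leR_mul_right _ _) hC.leR_inv
  have cqR : leR (f c) (f a * (f x * Y')) := by
    refine Or.inr ⟨B' * (f c * f c), ?_⟩
    have h₁ : f b * (B' * (f c * f c)) = f c * f c :=
      hB.mul_mul_cancel_of_leR (leR_trans (leR_mul_right _ _) cbR)
    rw [hq, mul_assoc, h₁, hC.mul_mul_cancel_of_leR' (Or.inl rfl)]
  have aqR : leR (f a) (f a * (f x * Y')) := by
    refine Or.inr ⟨f y * (X' * (A' * f a)), ?_⟩
    have h₁ : f x * (Y' * (f y * (X' * (A' * f a)))) = f x * (X' * (A' * f a)) := by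
      rw [← mul_assoc Y', ← mul_assoc, hY.mul_mul_cancel_of_leL (leL_trans xaL ayL)]
    have h₂ : f x * (X' * (A' * f a)) = A' * f a :=
      hX.mul_mul_cancel_of_leR
        (leR_trans (leR_mul_right _ _) (leR_trans hA.leR_inv axR))
    rw [mul_assoc, mul_assoc, h₁, h₂, ← mul_assoc, hA.2.1]
  have acR : leR (f a) (f c) := leR_trans aqR qcR
  have caR : leR (f c) (f a) := leR_trans cqR (leR_mul_right _ _)
  refine ⟨c * a, b, ⟨⟨(hind _ _).1.2 ?_, (hind _ _).1.2 ?_⟩, (hind _ _).2.2 ?_,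
    (hind _ _).2.2 ?_⟩, ⟨⟨(hind _ _).1.2 ?_, (hind _ _).1.2 ?_⟩, (hind _ _).2.2 ?_,
    (hind _ _).2.2 ?_⟩, hinj ?_⟩
  · rw [hmul]
    exact leL_mul_left _ _
  · rw [hmul]
    exact Or.inr ⟨C', (hC.mul_mul_cancel_of_leR' acR).symm⟩
  · rw [hmul]
    exact leR_trans (leR_mul_right _ _) caR
  · rw [hmul]
    refine leR_trans acR (Or.inr ⟨A' * (f c * C'), ?_⟩)
    rw [mul_assoc, hA.mul_mul_cancel_of_leR (leR_trans (leR_mul_right _ _) caR),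
      hC.mul_mul_cancel_of_leL' (Or.inl rfl)]
  · rw [hb, ← mul_assoc, ← mul_assoc]
    exact leL_trans (leL_mul_left _ _) (leL_trans hY.leL_inv yaL)
  · refine Or.inr ⟨f a * (f y * (X' * (A' * C'))), ?_⟩
    have h₁ : C' * (f c * (f a * (f x * Y'))) = f a * (f x * Y') :=
      hC.mul_mul_cancel_of_leR' qcR
    have h₂ : A' * (f a * (f x * Y')) = f x * Y' :=
      hA.mul_mul_cancel_of_leR' (leR_trans (leR_mul_right _ _) xaR)
    have h₃ : f y * (X' * (f x * Y')) = f y * Y' := by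
      rw [← mul_assoc X', ← mul_assoc, hX.mul_mul_cancel_of_leL (leL_trans yaL axL)]
    rw [hb]
    simp only [mul_assoc]
    rw [h₁, h₂, h₃, hY.mul_mul_cancel_of_leL' ayL]
  · exact leR_trans bcR caR
  · exact leR_trans acR cbR
  · rw [hmul, hmul, hmul, hb]
    simp only [mul_assoc]
    rw [hY.mul_mul_cancel_of_leL (leL_trans xaL ayL)]

/-! ### Embeddable pairs satisfying (GI) and (Gii) -/

/-- The consequences of embeddability, (GI) and (Gii) used to build the semigroup of straight
left quotients. -/
structure IsRegularStarPair [Semigroup S] (lel ler : S → S → Prop) : Prop where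
  l_refl : ∀ a, lel a a
  l_trans : ∀ {a b c}, lel a b → lel b c → lel a c
  r_refl : ∀ a, ler a a
  r_trans : ∀ {a b c}, ler a b → ler b c → ler a c
  l_mul : ∀ {a b} c, lel a b → lel (a * c) (b * c)
  r_mul : ∀ {a b} c, ler a b → ler (c * a) (c * b)
  r_star : ∀ {a b x y}, ler a b → x * b = y * b → x * a = y * a
  l_iff : ∀ {b c}, lel b c ↔ ∃ d, Lp lel b (d * c)
  r_iff : ∀ {b c}, ler b c ↔ ∃ d, Rp ler b (c * d)
  l_sq : ∀ a, lel a (a * a)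
  r_sq : ∀ a, ler a (a * a)
  r_of_l : ∀ {a b}, lel b a → ler b (b * a)
  l_of_r : ∀ {a b}, ler b a → lel b (a * b)
  mul_right_cancel : ∀ {a b c}, lel b a → lel c a → b * a = c * a → b = c
  mul_left_cancel : ∀ {a b c}, ler b a → ler c a → a * b = a * c → b = c
  l_cancel : ∀ {a b c}, lel b a → lel c a → Lp lel (b * a) (c * a) → Lp lel b c
  r_cancel : ∀ {a b c}, ler b a → ler c a → Rp ler (a * b) (a * c) → Rp ler b c
  ore : ∀ {x y}, Hp lel ler x y → ∃ u v, Hp lel ler u y ∧ Hp lel ler v y ∧ u * x = v * y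

theorem IsEmbeddableStarPair.isRegularStarPair [Semigroup S] {lel ler : S → S → Prop}
    (h : IsEmbeddableStarPair lel ler) (hI : CondGI lel ler) (hii : CondGii lel ler) :
    IsRegularStarPair lel ler := by
  obtain ⟨⟨h1, h2, h3, h4, h5, h6, h7, h8⟩, -, e2l, e2r, -, e5l, e5r, e6l, e6r, e7l, e7r⟩ := h
  have hG : ∀ a, a ∈ GS lel ler := fun a => hI ▸ Set.mem_univ a
  have hS : ∀ a, a ∈ SqSet S := fun a =>
    ⟨h7 _ _ (hG a).1.1, h7 _ _ (hG a).1.2, h8 _ _ (hG a).2.1, h8 _ _ (hG a).2.2⟩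
  refine
    { l_refl := h1
      l_trans := h2 _ _ _
      r_refl := h3
      r_trans := h4 _ _ _
      l_mul := h5 _ _
      r_mul := h6 _ _
      r_star := fun {a b x y} hab hxy => ?_
      l_iff := e2l _ _
      r_iff := e2r _ _
      l_sq := fun a => (hG a).1.1
      r_sq := fun a => (hG a).2.1
      r_of_l := fun hb => (e5l _ (hG _) _ hb).2
      l_of_r := fun hb => (e5r _ (hG _) _ hb).2
      mul_right_cancel := e6l _ (hG _) _ _
      mul_left_cancel := e6r _ (hG _) _ _
      l_cancel := e7l _ (hG _) _ _
      r_cancel := e7r _ (hG _) _ _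
      ore := fun {x y} hxy => ?_ }
  · have := h8 _ _ hab x y (by exact_mod_cast hxy)
    exact_mod_cast this
  · exact hii y (hS y) x y hxy ⟨⟨h1 _, h1 _⟩, h3 _, h3 _⟩

namespace IsRegularStarPair

variable [Semigroup S] {lel ler : S → S → Prop}

theorem r_mul_right (P : IsRegularStarPair lel ler) (a d : S) : ler (a * d) a :=
  P.r_iff.2 ⟨d, P.r_refl _, P.r_refl _⟩

theorem l_mul_left (P : IsRegularStarPair lel ler) (d a : S) : lel (d * a) a :=
  P.l_iff.2 ⟨d, P.l_refl _, P.l_refl _⟩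

end IsRegularStarPair

/-- The preorder `c R' ca`, which becomes `≤_J` in the semigroup of quotients. -/
def JBelow [Semigroup S] (ler : S → S → Prop) (c a : S) : Prop := ler c (c * a)

namespace IsRegularStarPair

variable [Semigroup S] {lel ler : S → S → Prop} {a b c x y : S}

theorem jBelow_iff (P : IsRegularStarPair lel ler) : JBelow ler c a ↔ lel c (a * c) := by
  constructor
  · intro h
    have := P.l_of_r h
    rw [mul_assoc] at this
    exact P.l_trans this (P.l_mul_left _ _)
  · intro h
    have := P.r_of_l h
    rw [← mul_assoc] at this
    exact P.r_trans this (P.r_mul_right _ _)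

theorem jBelow_of_r (P : IsRegularStarPair lel ler) (h : ler c a) : JBelow ler c a :=
  P.r_trans (P.r_sq c) (P.r_mul c h)

theorem jBelow_of_l (P : IsRegularStarPair lel ler) (h : lel c a) : JBelow ler c a :=
  P.jBelow_iff.2 (P.l_trans (P.l_sq c) (P.l_mul c h))

theorem jBelow_trans (P : IsRegularStarPair lel ler) (h₁ : JBelow ler c a)
    (h₂ : JBelow ler a b) : JBelow ler c b := by
  have h : lel c (b * a * c) := P.l_trans (P.jBelow_iff.1 h₁) (P.l_mul c (P.jBelow_iff.1 h₂))
  have h' : ler c (c * (b * a)) := P.jBelow_iff.2 h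
  rw [← mul_assoc] at h'
  exact P.r_trans h' (P.r_mul_right _ _)

theorem jBelow_mul (P : IsRegularStarPair lel ler) (h₁ : JBelow ler c a)
    (h₂ : JBelow ler c b) : JBelow ler c (a * b) := by
  have h : ler (c * a) (c * a * b) := P.jBelow_trans (P.jBelow_of_r (P.r_mul_right c a)) h₂
  rw [mul_assoc] at h
  exact P.r_trans h₁ h

theorem mul_jBelow_left (P : IsRegularStarPair lel ler) (a b : S) : JBelow ler (a * b) a :=
  P.jBelow_of_r (P.r_mul_right a b)

theorem mul_jBelow_right (P : IsRegularStarPair lel ler) (a b : S) : JBelow ler (a * b) b :=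
  P.jBelow_of_l (P.l_mul_left a b)

theorem exists_r_mul (P : IsRegularStarPair lel ler) (h : ler c a) :
    ∃ k, ler k a ∧ Rp ler c (a * k) := by
  obtain ⟨d, hd⟩ := P.r_iff.1 (P.r_trans h (P.r_sq a))
  exact ⟨a * d, P.r_mul_right _ _, by rwa [← mul_assoc]⟩

theorem rp_mul (P : IsRegularStarPair lel ler) (h : JBelow ler b c) : Rp ler (b * c) b :=
  ⟨P.r_mul_right _ _, h⟩

theorem lp_mul (P : IsRegularStarPair lel ler) (h : JBelow ler c b) : Lp lel (b * c) c :=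
  ⟨P.l_mul_left _ _, P.jBelow_iff.1 h⟩

theorem l_mul_of_lp_mul (P : IsRegularStarPair lel ler) (hb : ler b c)
    (h : Lp lel (x * c) (y * c)) : lel (x * b) (y * b) := by
  obtain ⟨d, hd⟩ := P.r_iff.1 hb
  set e := c * d with he
  have hxy : Lp lel (x * e) (y * e) := by
    rw [he, ← mul_assoc, ← mul_assoc]
    exact ⟨P.l_mul d h.1, P.l_mul d h.2⟩
  have j₁ : JBelow ler (x * e) (y * e) := P.jBelow_of_l hxy.1
  have j₂ : JBelow ler (y * e) (x * e) := P.jBelow_of_l hxy.2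
  have jr : ∀ z, JBelow ler z z := fun z => P.jBelow_of_r (P.r_refl z)
  have r₁ := P.rp_mul (jr (x * e))
  have r₂ := P.rp_mul j₁
  have l₁ := P.lp_mul (jr (x * e))
  have l₂ := P.lp_mul j₂
  obtain ⟨u, v, hu, -, huv⟩ := P.ore (x := x * e * (x * e)) (y := x * e * (y * e))
    ⟨⟨P.l_trans l₁.1 (P.l_trans hxy.1 l₂.2), P.l_trans l₂.1 (P.l_trans hxy.2 l₁.2)⟩,
      P.r_trans r₁.1 r₂.2, P.r_trans r₂.1 r₁.2⟩
  have huv' : u * (x * e) * x * b = v * (x * e) * y * b :=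
    P.r_star hd.1 (by simpa only [mul_assoc] using huv)
  have jb : JBelow ler (x * b) (x * e) := P.jBelow_of_r (P.r_mul x hd.1)
  have ju : JBelow ler (x * b) u :=
    P.jBelow_trans (P.jBelow_trans jb (P.jBelow_of_r r₂.2)) (P.jBelow_of_l hu.1.2)
  have key := P.jBelow_iff.1 (P.jBelow_mul ju jb)
  rw [← mul_assoc, huv', mul_assoc] at key
  exact P.l_trans key (P.l_mul_left _ _)

theorem lp_mul_of_lp_mul (P : IsRegularStarPair lel ler) (hb : ler b c)
    (h : Lp lel (x * c) (y * c)) : Lp lel (x * b) (y * b) :=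
  ⟨P.l_mul_of_lp_mul hb h, P.l_mul_of_lp_mul hb h.symm⟩

theorem rp_mul_of_rp_mul (P : IsRegularStarPair lel ler) (hb : lel b c)
    (h : Rp ler (c * x) (c * y)) : Rp ler (b * x) (b * y) := by
  obtain ⟨d, hd⟩ := P.l_iff.1 hb
  have r := P.rp_mul (P.jBelow_of_l hd.1)
  have l := P.lp_mul (P.jBelow_of_l hd.2)
  obtain ⟨u, v, -, hv, huv⟩ := P.ore (x := b * (d * c)) (y := b)
    ⟨⟨P.l_trans l.1 hd.2, P.l_trans hd.1 l.2⟩, r⟩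
  have e : ∀ z, v * (b * z) = u * b * d * (c * z) := fun z => by
    rw [← mul_assoc, ← huv]
    simp only [mul_assoc]
  have hz : ∀ z, ler (b * z) v := fun z => P.r_trans (P.r_mul_right b z) hv.2.2
  refine P.r_cancel (hz x) (hz y) ?_
  rw [e, e]
  exact ⟨P.r_mul _ h.1, P.r_mul _ h.2⟩

end IsRegularStarPair

/-! ### Straight left quotients inside a semigroup with enough group inverses -/

/-- A multiplicative map into a semigroup `T` in which all elements of `S` acquire group
inverses, compatibly with the given pair of preorders. -/
structure IsInvertingMap [Semigroup S] (lel ler : S → S → Prop) {T : Type u} [Semigroup T]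
    (f I : S → T) : Prop where
  inj : Function.Injective f
  map_mul : ∀ a b, f (a * b) = f a * f b
  inv : ∀ a, IsGroupInverse (f a) (I a)
  mul_of_l : ∀ {b c}, lel b c → f b * (I c * f c) = f b
  mul_of_r : ∀ {b c}, ler b c → f c * (I c * f b) = f b
  l_of : ∀ {b c}, leL (f b) (f c) → lel b c
  r_of : ∀ {b c}, leR (f b) (f c) → ler b c

namespace IsInvertingMap

variable [Semigroup S] {lel ler : S → S → Prop} {T : Type u} [Semigroup T] {f I : S → T}
  {a b c v z : S}

theorem leR_of (F : IsInvertingMap lel ler f I) (h : ler b c) : leR (f b) (f c) :=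
  Or.inr ⟨I c * f b, (F.mul_of_r h).symm⟩

theorem leL_of (F : IsInvertingMap lel ler f I) (h : lel b c) : leL (f b) (f c) :=
  Or.inr ⟨f b * I c, by rw [mul_assoc, F.mul_of_l h]⟩

/-- `b c♯` is a straight left quotient. -/
theorem exists_mul_inv_eq (F : IsInvertingMap lel ler f I) (P : IsRegularStarPair lel ler)
    (b c : S) : ∃ v w, ler w v ∧ ler v b ∧ f b * I c = I v * f w := by
  have hp : lel (b * c) (c * (c * c)) :=
    P.l_trans (P.l_mul_left b c) (P.l_trans (P.l_sq c)
      (by simpa only [mul_assoc] using P.l_mul c (P.l_sq c)))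
  obtain ⟨k, hk⟩ := P.l_iff.1 hp
  have r := P.rp_mul (P.jBelow_of_l hk.1)
  have l := P.lp_mul (P.jBelow_of_l hk.2)
  obtain ⟨u, v, hu, hv, huv⟩ := P.ore (x := b * c * (k * (c * (c * c)))) (y := b * c)
    ⟨⟨P.l_trans l.1 hk.2, P.l_trans hk.1 l.2⟩, r⟩
  refine ⟨v, u * (b * c) * (k * c), ?_, P.r_trans hv.2.1 (P.r_mul_right b c), ?_⟩
  · rw [mul_assoc]
    exact P.r_trans (P.r_mul_right _ _) (P.r_trans hu.2.1 hv.2.2)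
  · have h₁ : f b * I c = f (b * c) * (I c * I c) := by
      rw [F.map_mul, mul_assoc, (F.inv c).mul_mul_cancel_of_leR (F.inv c).leR_inv]
    have h₂ : f (b * c) * (I c * I c) = I v * (f (v * (b * c)) * (I c * I c)) := by
      rw [F.map_mul v, mul_assoc, (F.inv v).mul_mul_cancel_of_leR'
        (leR_trans (leR_mul_right _ _) (F.leR_of hv.2.2))]
    have h₃ : f (v * (b * c)) * (I c * I c) = f (u * (b * c) * (k * c)) * (f c * I c) := by
      have : v * (b * c) = u * (b * c) * (k * c) * c * c := by
        rw [← huv]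
        simp only [mul_assoc]
      rw [this, F.map_mul _ c, F.map_mul _ c, mul_assoc, mul_assoc,
        (F.inv c).mul_mul_cancel_of_leR (F.inv c).leR_inv]
    have h₄ : f (u * (b * c) * (k * c)) * (f c * I c) = f (u * (b * c) * (k * c)) := by
      refine (F.inv c).mul_mul_cancel_of_leL' (F.leL_of ?_)
      rw [← mul_assoc]
      exact P.l_mul_left _ _
    rw [h₁, h₂, h₃, h₄]

/-- `a♯ v♯ z` is a straight left quotient if `z ≤_r v ≤_r a`. -/
theorem exists_inv_mul_inv_mul_eq (F : IsInvertingMap lel ler f I)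
    (P : IsRegularStarPair lel ler) (hzv : ler z v) (hva : ler v a) :
    ∃ x y, Rp ler x y ∧ I a * (I v * f z) = I x * f y := by
  obtain ⟨j, hjv, hzj⟩ := P.exists_r_mul hzv
  obtain ⟨k, hka, hjk⟩ := P.exists_r_mul (P.r_trans hjv hva)
  have kj : JBelow ler k j := P.jBelow_trans
    (P.jBelow_of_l (P.lp_mul (P.jBelow_of_r hka)).2) (P.jBelow_of_r hjk.2)
  have jz : JBelow ler j z := P.jBelow_trans
    (P.jBelow_of_l (P.lp_mul (P.jBelow_of_r hjv)).2) (P.jBelow_of_r hzj.2)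
  have hx := P.rp_mul (P.jBelow_mul (P.jBelow_trans kj (P.jBelow_of_r hjv))
    (P.jBelow_of_r hka))
  have hy := P.rp_mul (P.jBelow_trans kj jz)
  refine ⟨k * (v * a), k * z, ⟨P.r_trans hx.1 hy.2, P.r_trans hy.1 hx.2⟩, ?_⟩
  have w₁ : leR (I v * f z) (f j) := by
    refine Or.inr ⟨I (v * j) * f z, ?_⟩
    calc I v * f z = I v * (f (v * j) * (I (v * j) * f z)) := by rw [F.mul_of_r hzj.1]
      _ = I v * (f v * (f j * (I (v * j) * f z))) := by rw [F.map_mul, mul_assoc]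
      _ = f j * (I (v * j) * f z) := (F.inv v).mul_mul_cancel_of_leR'
          (leR_trans (leR_mul_right _ _) (F.leR_of hjv))
  have w₂ : leR (I a * (I v * f z)) (f k) := by
    refine Or.inr ⟨I (a * k) * (I v * f z), ?_⟩
    calc I a * (I v * f z) = I a * (f (a * k) * (I (a * k) * (I v * f z))) := by
          rw [(F.inv _).mul_mul_cancel_of_leR (leR_trans w₁ (F.leR_of hjk.1))]
      _ = I a * (f a * (f k * (I (a * k) * (I v * f z)))) := by rw [F.map_mul, mul_assoc]
      _ = f k * (I (a * k) * (I v * f z)) := (F.inv a).mul_mul_cancel_of_leR'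
          (leR_trans (leR_mul_right _ _) (F.leR_of hka))
  have h₁ : f (k * (v * a)) * (I a * (I v * f z)) = f (k * z) := by
    have e₁ : f a * (I a * (I v * f z)) = I v * f z := (F.inv a).mul_mul_cancel_of_leR
      (leR_trans (leR_mul_right _ _) (leR_trans (F.inv v).leR_inv (F.leR_of hva)))
    rw [F.map_mul, F.map_mul, mul_assoc, mul_assoc, e₁, F.mul_of_r hzv, F.map_mul]
  rw [← h₁, (F.inv _).mul_mul_cancel_of_leR' (leR_trans w₂ (F.leR_of hx.2))]

/-- The semigroup of straight left quotients of `S` in `T`. -/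
def quotients (F : IsInvertingMap lel ler f I) (P : IsRegularStarPair lel ler) :
    Subsemigroup T where
  carrier := { t | ∃ a b, Rp ler a b ∧ t = I a * f b }
  mul_mem' := by
    rintro _ _ ⟨a, b, hab, rfl⟩ ⟨c, d, -, rfl⟩
    obtain ⟨v, w, hwv, hvb, e⟩ := F.exists_mul_inv_eq P b c
    obtain ⟨x, y, hxy, e'⟩ := F.exists_inv_mul_inv_mul_eq P
      (P.r_trans (P.r_mul_right w d) hwv) (P.r_trans hvb hab.2)
    refine ⟨x, y, hxy, ?_⟩
    rw [← e', F.map_mul, ← mul_assoc (I v), ← e]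
    simp only [mul_assoc]

theorem map_mem_quotients (F : IsInvertingMap lel ler f I) (P : IsRegularStarPair lel ler)
    (a : S) : f a ∈ F.quotients P :=
  ⟨a, a * a, ⟨P.r_sq a, P.r_mul_right a a⟩, by
    rw [F.map_mul, (F.inv a).mul_mul_cancel_of_leR' (Or.inl rfl)]⟩

theorem inv_mem_quotients (F : IsInvertingMap lel ler f I) (P : IsRegularStarPair lel ler)
    (a : S) : I a ∈ F.quotients P := by
  refine ⟨a * a, a, ⟨P.r_mul_right a a, P.r_sq a⟩, ?_⟩
  have h := F.inv (a * a)
  rw [F.map_mul] at h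
  rw [h.unique (F.inv a).sq, mul_assoc,
    (F.inv a).symm.mul_mul_cancel_of_leL' (Or.inl rfl)]

theorem isGroupInverse_quotients (F : IsInvertingMap lel ler f I)
    (P : IsRegularStarPair lel ler) (a : S) :
    IsGroupInverse (⟨f a, F.map_mem_quotients P a⟩ : F.quotients P)
      ⟨I a, F.inv_mem_quotients P a⟩ :=
  ⟨Subtype.ext (F.inv a).1, Subtype.ext (F.inv a).2.1, Subtype.ext (F.inv a).2.2⟩

theorem leR_quotients (F : IsInvertingMap lel ler f I) (P : IsRegularStarPair lel ler)
    (h : ler b c) : leR (⟨f b, F.map_mem_quotients P b⟩ : F.quotients P)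
      ⟨f c, F.map_mem_quotients P c⟩ :=
  Or.inr ⟨⟨I c, F.inv_mem_quotients P c⟩ * ⟨f b, F.map_mem_quotients P b⟩,
    Subtype.ext (F.mul_of_r h).symm⟩

theorem leL_quotients (F : IsInvertingMap lel ler f I) (P : IsRegularStarPair lel ler)
    (h : lel b c) : leL (⟨f b, F.map_mem_quotients P b⟩ : F.quotients P)
      ⟨f c, F.map_mem_quotients P c⟩ :=
  Or.inr ⟨⟨f b, F.map_mem_quotients P b⟩ * ⟨I c, F.inv_mem_quotients P c⟩,
    Subtype.ext (by
      change f b = f b * I c * f c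
      rw [mul_assoc, F.mul_of_l h])⟩

theorem completelyRegular_quotients (F : IsInvertingMap lel ler f I)
    (P : IsRegularStarPair lel ler) : CompletelyRegular (F.quotients P) := by
  rintro ⟨_, a, b, hab, rfl⟩
  have hbm := F.map_mem_quotients P b
  have hbi := F.inv_mem_quotients P b
  refine ⟨⟨I b * (f a * (f b * I b)), mul_mem hbi
    (mul_mem (F.map_mem_quotients P a) (mul_mem hbm hbi))⟩, ?_⟩
  have hab' := F.leR_of hab.1
  have hba' := F.leR_of hab.2
  have hc : I b * f b = f b * I b := (F.inv b).1.symm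
  have e₁ : I a * f b * (I b * (f a * (f b * I b))) = f b * I b := by
    have h₁ : f b * (I b * (f a * (f b * I b))) = f a * (f b * I b) :=
      (F.inv b).mul_mul_cancel_of_leR (leR_trans (leR_mul_right _ _) hab')
    rw [mul_assoc, h₁, (F.inv a).mul_mul_cancel_of_leR' (leR_trans (leR_mul_right _ _) hba')]
  have e₂ : I b * (f a * (f b * I b)) * (I a * f b) = f b * I b := by
    have h₁ : f b * (I b * (I a * f b)) = I a * f b := (F.inv b).mul_mul_cancel_of_leR
      (leR_trans (leR_mul_right _ _) (leR_trans (F.inv a).leR_inv hab'))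
    have h₂ : f a * (I a * f b) = f b := F.mul_of_r hab.2
    rw [mul_assoc, mul_assoc, mul_assoc, h₁, h₂, hc]
  refine ⟨Subtype.ext (e₁.trans e₂.symm), Subtype.ext ?_, Subtype.ext ?_⟩
  · change I a * f b * (I b * (f a * (f b * I b))) * (I a * f b) = I a * f b
    rw [e₁, mul_assoc]
    exact (F.inv b).mul_mul_cancel_of_leR
      (leR_trans (leR_mul_right _ _) (leR_trans (F.inv a).leR_inv hab'))
  · change I b * (f a * (f b * I b)) * (I a * f b) * (I b * (f a * (f b * I b))) =
      I b * (f a * (f b * I b))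
    rw [e₂, mul_assoc]
    exact (F.inv b).mul_mul_cancel_of_leR (leR_trans (leR_mul_right _ _) (F.inv b).leR_inv)

theorem straightLeftOrderExtension_quotients (F : IsInvertingMap lel ler f I)
    (P : IsRegularStarPair lel ler) : StraightLeftOrderExtension lel ler (F.quotients P)
      fun a => ⟨f a, F.map_mem_quotients P a⟩ := by
  refine ⟨fun a b h => F.inj (congrArg Subtype.val h), fun a b => Subtype.ext (F.map_mul a b),
    ?_, fun a _ => ⟨_, F.isGroupInverse_quotients P a⟩, fun b c =>
    ⟨⟨F.leL_quotients P, fun h => F.l_of ?_⟩, ⟨F.leR_quotients P, fun h => F.r_of ?_⟩⟩⟩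
  · rintro ⟨_, a, b, hab, rfl⟩
    exact ⟨a, b, ⟨_, F.isGroupInverse_quotients P a, rfl⟩, F.leR_quotients P hab.1,
      F.leR_quotients P hab.2⟩
  · exact h.imp (congrArg Subtype.val) fun ⟨x, hx⟩ => ⟨x, congrArg Subtype.val hx⟩
  · exact h.imp (congrArg Subtype.val) fun ⟨x, hx⟩ => ⟨x, congrArg Subtype.val hx⟩

end IsInvertingMap

/-! ### Three representations -/

namespace IsRegularStarPair

variable [Semigroup S] {lel ler : S → S → Prop}

/-- The equivalence `R'` as a setoid. -/
def rSetoid (P : IsRegularStarPair lel ler) : Setoid S where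
  r := Rp ler
  iseqv := ⟨fun a => ⟨P.r_refl a, P.r_refl a⟩, And.symm,
    fun h k => ⟨P.r_trans h.1 k.1, P.r_trans k.2 h.2⟩⟩

/-- The equivalence `L'` as a setoid. -/
def lSetoid (P : IsRegularStarPair lel ler) : Setoid S where
  r := Lp lel
  iseqv := ⟨fun a => ⟨P.l_refl a, P.l_refl a⟩, And.symm,
    fun h k => ⟨P.l_trans h.1 k.1, P.l_trans k.2 h.2⟩⟩

/-- The left action of `S` on the set of `R'`-classes. -/
def rAct (P : IsRegularStarPair lel ler) (s : S) : Function.End (Quotient P.rSetoid) :=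
  Quotient.map (s * ·) fun _ _ h => ⟨P.r_mul s h.1, P.r_mul s h.2⟩

/-- The right action of `S` on the set of `L'`-classes. -/
def lAct (P : IsRegularStarPair lel ler) (s : S) : Function.End (Quotient P.lSetoid) :=
  Quotient.map (· * s) fun _ _ h => ⟨P.l_mul s h.1, P.l_mul s h.2⟩

/-- Equality of the formal quotients `a♯b` with `b ≤_r a`, where all non-straight ones (those
with `b <_r a`) are identified. -/
def fracSetoid (P : IsRegularStarPair lel ler) : Setoid { p : S × S // ler p.2 p.1 } where
  r p q := (ler p.1.1 p.1.2 ↔ ler q.1.1 q.1.2) ∧ (ler p.1.1 p.1.2 → Rp ler p.1.1 q.1.1 ∧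
    ∃ x y, Rp ler x p.1.1 ∧ Rp ler y p.1.1 ∧ x * p.1.1 * p.1.1 = y * q.1.1 * p.1.1 ∧
      x * p.1.2 = y * q.1.2)
  iseqv := by
    refine ⟨fun p => ⟨Iff.rfl, fun _ => ⟨⟨P.r_refl _, P.r_refl _⟩, p.1.1, p.1.1,
      ⟨P.r_refl _, P.r_refl _⟩, ⟨P.r_refl _, P.r_refl _⟩, rfl, rfl⟩⟩, ?_, ?_⟩
    · rintro ⟨⟨a, b⟩, hb⟩ ⟨⟨c, d⟩, hd⟩ ⟨hg, h⟩
      refine ⟨hg.symm, fun hq => ?_⟩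
      obtain ⟨hac, x, y, hx, hy, e₁, e₂⟩ := h (hg.2 hq)
      exact ⟨hac.symm, y, x, ⟨P.r_trans hy.1 hac.1, P.r_trans hac.2 hy.2⟩,
        ⟨P.r_trans hx.1 hac.1, P.r_trans hac.2 hx.2⟩, (P.r_star hac.2 e₁).symm, e₂.symm⟩
    · rintro ⟨⟨a, b⟩, hb⟩ ⟨⟨c, d⟩, hd⟩ ⟨⟨e, f⟩, hf⟩ ⟨hg, h⟩ ⟨hg', h'⟩
      dsimp only at *
      refine ⟨hg.trans hg', fun hp => ?_⟩
      obtain ⟨hac, x, y, hx, hy, e₁, e₂⟩ := h hp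
      obtain ⟨hce, z, w, hz, hw, e₃, e₄⟩ := h' (hg.1 hp)
      have hza : Rp ler z a := ⟨P.r_trans hz.1 hac.2, P.r_trans hac.1 hz.2⟩
      have hwa : Rp ler w a := ⟨P.r_trans hw.1 hac.2, P.r_trans hac.1 hw.2⟩
      have key : ∀ {t}, Rp ler t a → Rp ler (t * a) a ∧ Lp lel (t * a) a := fun {t} ht =>
        ⟨⟨P.r_trans (P.r_mul_right _ _) ht.1, P.r_trans ht.2 (P.jBelow_of_r ht.1)⟩,
          P.lp_mul (P.jBelow_of_r ht.2)⟩
      obtain ⟨ry, ly⟩ := key hy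
      obtain ⟨rz, lz⟩ := key hza
      obtain ⟨u, v, hu, hv, huv⟩ := P.ore (x := y * a) (y := z * a)
        ⟨⟨P.l_trans ly.1 lz.2, P.l_trans lz.1 ly.2⟩, P.r_trans ry.1 rz.2,
          P.r_trans rz.1 ry.2⟩
      have hua : Rp ler u a := ⟨P.r_trans hu.2.1 rz.1, P.r_trans rz.2 hu.2.2⟩
      have hva : Rp ler v a := ⟨P.r_trans hv.2.1 rz.1, P.r_trans rz.2 hv.2.2⟩
      have hmul : ∀ {s t}, Rp ler s a → Rp ler t a → Rp ler (s * t) a := fun {s t} hs ht =>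
        ⟨P.r_trans (P.r_mul_right _ _) hs.1,
          P.r_trans hs.2 (P.jBelow_of_r (P.r_trans hs.1 ht.2))⟩
      have huv' : ∀ t, ler t a → u * y * t = v * z * t := fun t ht =>
        P.r_star ht (by simpa only [mul_assoc] using huv)
      refine ⟨⟨P.r_trans hac.1 hce.1, P.r_trans hce.2 hac.2⟩, u * x, v * w, hmul hua hx,
        hmul hva hwa, ?_, ?_⟩
      · calc u * x * a * a = u * (x * a * a) := by simp only [mul_assoc]
          _ = u * y * (c * a) := by rw [e₁]; simp only [mul_assoc]
          _ = v * z * (c * a) := huv' _ (P.r_trans (P.r_mul_right _ _) hac.2)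
          _ = v * (z * c * a) := by simp only [mul_assoc]
          _ = v * w * e * a := by rw [P.r_star hac.1 e₃]; simp only [mul_assoc]
      · calc u * x * b = u * y * d := by rw [mul_assoc, e₂, mul_assoc]
          _ = v * z * d := huv' _ (P.r_trans hd hac.2)
          _ = v * w * f := by rw [mul_assoc, e₄, mul_assoc]

/-- The right action of `S` on formal quotients. -/
def fracAct (P : IsRegularStarPair lel ler) (s : S) : Function.End (Quotient P.fracSetoid) :=
  Quotient.map (fun p => ⟨(p.1.1, p.1.2 * s), P.r_trans (P.r_mul_right _ _) p.2⟩) (by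
    have main : ∀ {a b c d : S}, ler b a → ler d c → Rp ler a c → ler c d → ler a (b * s) →
        ler c (d * s) := fun {a b c d} hb hd hac hcd h =>
      P.r_trans hcd (P.jBelow_trans (P.jBelow_of_r (P.r_trans hd (P.r_trans hac.2 h)))
        (P.mul_jBelow_right _ _))
    rintro ⟨⟨a, b⟩, hb⟩ ⟨⟨c, d⟩, hd⟩ ⟨hg, h⟩
    dsimp only at *
    have good : ∀ {b : S}, ler a (b * s) → ler a b := fun h => P.r_trans h (P.r_mul_right _ _)
    refine ⟨⟨fun h' => ?_, fun h' => ?_⟩, fun h' => ?_⟩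
    · have ha := P.r_trans h' (P.r_mul_right _ _)
      exact main hb hd (h ha).1 (hg.1 ha) h'
    · have hc := hg.2 (P.r_trans h' (P.r_mul_right _ _))
      exact main hd hb (h hc).1.symm hc h'
    · obtain ⟨hac, x, y, hx, hy, e₁, e₂⟩ := h (P.r_trans h' (P.r_mul_right _ _))
      exact ⟨hac, x, y, hx, hy, e₁, by
        change x * (b * s) = y * (d * s)
        rw [← mul_assoc, e₂, mul_assoc]⟩)

theorem exists_fracAct_eq (P : IsRegularStarPair lel ler) {a b s : S} (hba : ler b a)
    (hb : lel b s) : ∃ q, P.fracAct s q = Quotient.mk P.fracSetoid ⟨(a, b), hba⟩ := by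
  by_cases hab : ler a b
  · obtain ⟨k, hk⟩ := P.l_iff.1 hb
    have jka : JBelow ler (k * s) a :=
      P.jBelow_trans (P.jBelow_of_l hk.2) (P.jBelow_of_r hba)
    have jak : JBelow ler a (k * s) :=
      P.jBelow_trans (P.jBelow_of_r hab) (P.jBelow_of_l hk.1)
    have l := P.lp_mul jka
    have r := P.rp_mul jak
    obtain ⟨u, v, hu, hv, huv⟩ := P.ore (x := a * (k * s)) (y := b)
      ⟨⟨P.l_trans l.1 hk.2, P.l_trans hk.1 l.2⟩, P.r_trans r.1 hab, P.r_trans hba r.2⟩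
    have hva : ler v a := P.r_trans hv.2.1 hba
    have hav : ler a v := P.r_trans hab hv.2.2
    have rva := P.rp_mul (P.jBelow_of_r hva)
    have rav := P.rp_mul (P.jBelow_of_r hav)
    have hq : ler (u * (a * k)) (v * a) := P.r_trans (P.r_mul_right _ _)
      (P.r_trans hu.2.1 (P.r_trans hv.2.2 rva.2))
    have e : u * (a * k) * s = v * b := by rw [← huv]; simp only [mul_assoc]
    have hvb : ler v (v * b) := P.jBelow_of_r hv.2.1
    refine ⟨Quotient.mk P.fracSetoid ⟨(v * a, u * (a * k)), hq⟩, Quotient.sound ?_⟩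
    refine ⟨⟨fun _ => hab, fun _ => ?_⟩, fun _ => ⟨⟨P.r_trans rva.1 hva,
      P.r_trans hav rva.2⟩, a, a * v, ⟨P.r_trans hav rva.2, P.r_trans rva.1 hva⟩,
      ⟨P.r_trans rav.1 (P.r_trans hav rva.2), P.r_trans rva.1 (P.r_trans hva rav.2)⟩, ?_, ?_⟩⟩
    · change ler (v * a) (u * (a * k) * s)
      rw [e]
      exact P.r_trans rva.1 hvb
    · simp only [mul_assoc]
    · change a * (u * (a * k) * s) = a * v * b
      rw [e, mul_assoc]
  · have hn : ¬ ler a (b * s) := fun h => hab (P.r_trans h (P.r_mul_right _ _))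
    exact ⟨Quotient.mk P.fracSetoid ⟨(a, b), hba⟩,
      Quotient.sound ⟨iff_of_false hn hab, fun h => absurd h hn⟩⟩

theorem fracAct_injOn (P : IsRegularStarPair lel ler) (s : S) (p q : Quotient P.fracSetoid)
    (h : P.fracAct s (P.fracAct s p) = P.fracAct s (P.fracAct s q)) :
    P.fracAct s p = P.fracAct s q := by
  induction p using Quotient.inductionOn with | _ p
  induction q using Quotient.inductionOn with | _ q
  obtain ⟨⟨a, b⟩, hb⟩ := p
  obtain ⟨⟨c, d⟩, hd⟩ := q
  obtain ⟨hg, h⟩ := Quotient.exact h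
  dsimp only at hg h
  have good : ∀ a b : S, ler a (b * s * s) ↔ ler a (b * s) := fun a b =>
    ⟨fun h => P.r_trans h (P.r_mul_right _ _),
      fun h => P.r_trans h (P.mul_jBelow_right _ _)⟩
  rw [good, good] at hg
  refine Quotient.sound ⟨hg, fun h' => ?_⟩
  obtain ⟨hac, x, y, hx, hy, e₁, e₂⟩ := h ((good _ _).2 h')
  refine ⟨hac, x, y, hx, hy, e₁, P.mul_right_cancel (a := s) ?_ ?_ ?_⟩
  · rw [← mul_assoc]
    exact P.l_mul_left _ _
  · rw [← mul_assoc]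
    exact P.l_mul_left _ _
  · simpa only [mul_assoc] using e₂

theorem fracAct_eq_of_r (P : IsRegularStarPair lel ler) {b c : S} (hbc : ler b c)
    (p q : Quotient P.fracSetoid) (h : P.fracAct c p = P.fracAct c q) :
    P.fracAct b p = P.fracAct b q := by
  induction p using Quotient.inductionOn with | _ p
  induction q using Quotient.inductionOn with | _ q
  obtain ⟨⟨a, d⟩, hd⟩ := p
  obtain ⟨⟨a', d'⟩, hd'⟩ := q
  obtain ⟨hg, h⟩ := Quotient.exact h
  dsimp only at hg h hd hd'
  have up : ∀ a d : S, ler a (d * b) → ler a (d * c) := fun a d h =>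
    P.r_trans h (P.r_mul d hbc)
  have main : ∀ {a d a' d' : S}, ler d' a' → Rp ler a a' → ler a (d * b) → ler a' (d' * c) →
      ler a' (d' * b) := fun {a d a' d'} hd' haa hab hac =>
    P.r_trans (P.r_trans hac (P.r_mul_right _ _)) (P.jBelow_trans
      (P.jBelow_of_r (P.r_trans hd' (P.r_trans haa.2 hab))) (P.mul_jBelow_right _ _))
  refine Quotient.sound ⟨⟨fun h' => ?_, fun h' => ?_⟩, fun h' => ?_⟩
  · have hc := up _ _ h'
    exact main hd' (h hc).1 h' (hg.1 hc)
  · have hc := hg.2 (up _ _ h')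
    exact main hd (h hc).1.symm h' hc
  · obtain ⟨haa, x, y, hx, hy, e₁, e₂⟩ := h (up _ _ h')
    refine ⟨haa, x, y, hx, hy, e₁, ?_⟩
    have := P.r_star (x := x * d) (y := y * d') hbc (by simpa only [mul_assoc] using e₂)
    simpa only [mul_assoc] using this

theorem exists_rAct_eq (P : IsRegularStarPair lel ler) {b s : S} (h : ler b s) :
    ∃ q, P.rAct s q = Quotient.mk P.rSetoid b := by
  obtain ⟨d, hd⟩ := P.r_iff.1 h
  exact ⟨Quotient.mk P.rSetoid d, Quotient.sound hd.symm⟩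

theorem exists_lAct_eq (P : IsRegularStarPair lel ler) {b s : S} (h : lel b s) :
    ∃ q, P.lAct s q = Quotient.mk P.lSetoid b := by
  obtain ⟨d, hd⟩ := P.l_iff.1 h
  exact ⟨Quotient.mk P.lSetoid d, Quotient.sound hd.symm⟩

theorem rAct_mul (P : IsRegularStarPair lel ler) (a b : S) :
    P.rAct (a * b) = P.rAct a * P.rAct b := by
  funext q
  induction q using Quotient.inductionOn with | _ x
  exact congrArg (Quotient.mk P.rSetoid) (mul_assoc a b x)

theorem lAct_mul (P : IsRegularStarPair lel ler) (a b : S) :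
    P.lAct (a * b) = P.lAct b * P.lAct a := by
  funext q
  induction q using Quotient.inductionOn with | _ x
  exact congrArg (Quotient.mk P.lSetoid) (mul_assoc x a b).symm

theorem fracAct_mul (P : IsRegularStarPair lel ler) (a b : S) :
    P.fracAct (a * b) = P.fracAct b * P.fracAct a := by
  funext q
  induction q using Quotient.inductionOn with | _ x
  exact congrArg (Quotient.mk P.fracSetoid)
    (Subtype.ext (Prod.ext rfl (mul_assoc x.1.2 a b).symm))

theorem exists_inv_rAct (P : IsRegularStarPair lel ler) (s : S) :
    ∃ h, IsGroupInverse (P.rAct s) h := by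
  refine IsGroupInverse.exists_of_end _ (fun q => ?_) fun p q h => ?_
  · induction q using Quotient.inductionOn with | _ x
    obtain ⟨q, hq⟩ := P.exists_rAct_eq (P.r_trans (P.r_mul_right s x) (P.r_sq s))
    rw [rAct_mul] at hq
    exact ⟨q, hq⟩
  · induction p using Quotient.inductionOn with | _ x
    induction q using Quotient.inductionOn with | _ y
    exact Quotient.sound (P.r_cancel (P.r_mul_right s x) (P.r_mul_right s y) (Quotient.exact h))

theorem exists_inv_lAct (P : IsRegularStarPair lel ler) (s : S) :
    ∃ h, IsGroupInverse (P.lAct s) h := by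
  refine IsGroupInverse.exists_of_end _ (fun q => ?_) fun p q h => ?_
  · induction q using Quotient.inductionOn with | _ x
    obtain ⟨q, hq⟩ := P.exists_lAct_eq (P.l_trans (P.l_mul_left x s) (P.l_sq s))
    rw [lAct_mul] at hq
    exact ⟨q, hq⟩
  · induction p using Quotient.inductionOn with | _ x
    induction q using Quotient.inductionOn with | _ y
    exact Quotient.sound (P.l_cancel (P.l_mul_left x s) (P.l_mul_left y s) (Quotient.exact h))

theorem exists_inv_fracAct (P : IsRegularStarPair lel ler) (s : S) :
    ∃ h, IsGroupInverse (P.fracAct s) h := by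
  refine IsGroupInverse.exists_of_end _ (fun q => ?_) (P.fracAct_injOn s)
  induction q using Quotient.inductionOn with | _ x
  obtain ⟨q, hq⟩ := P.exists_fracAct_eq (P.r_trans (P.r_mul_right x.1.2 s) x.2)
    (P.l_trans (P.l_mul_left x.1.2 s) (P.l_sq s))
  rw [fracAct_mul] at hq
  exact ⟨q, hq⟩

end IsRegularStarPair

theorem IsGroupInverse.op [Semigroup Q] {q h : Q} (H : IsGroupInverse q h) :
    IsGroupInverse (MulOpposite.op q) (MulOpposite.op h) :=
  ⟨congrArg MulOpposite.op H.1.symm,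
    congrArg MulOpposite.op ((mul_assoc q h q).symm.trans H.2.1),
    congrArg MulOpposite.op ((mul_assoc h q h).symm.trans H.2.2)⟩

theorem IsGroupInverse.end_apply {X : Type*} {g h : Function.End X} (H : IsGroupInverse g h)
    (x : X) : g (h (g x)) = g x :=
  congrFun H.2.1 x

/-- A map whose range lies in that of `g` is fixed by the idempotent `g * h`. -/
theorem IsGroupInverse.end_mul_mul_of_range {X : Type*} {g h p : Function.End X}
    (H : IsGroupInverse g h) (hp : ∀ x, ∃ y, g y = p x) : g * (h * p) = p := by
  funext x
  obtain ⟨y, hy⟩ := hp x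
  change g (h (p x)) = p x
  rw [← hy, H.end_apply]

/-- A map whose kernel contains that of `g` is fixed by the idempotent `h * g`. -/
theorem IsGroupInverse.end_mul_mul_of_ker {X : Type*} {g h p : Function.End X}
    (H : IsGroupInverse g h) (hp : ∀ x y, g x = g y → p x = p y) : p * (h * g) = p := by
  funext x
  exact hp _ _ (H.end_apply x)

namespace IsRegularStarPair

variable [Semigroup S] {lel ler : S → S → Prop}

theorem exists_isInvertingMap (P : IsRegularStarPair lel ler) :
    ∃ (T : Type u) (_ : Semigroup T) (f I : S → T), IsInvertingMap lel ler f I := by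
  choose I₁ h₁ using P.exists_inv_rAct
  choose I₂ h₂ using P.exists_inv_lAct
  choose I₃ h₃ using P.exists_inv_fracAct
  refine ⟨Function.End (Quotient P.rSetoid) × (Function.End (Quotient P.lSetoid))ᵐᵒᵖ ×
    (Function.End (Quotient P.fracSetoid))ᵐᵒᵖ, inferInstance,
    fun s => (P.rAct s, .op (P.lAct s), .op (P.fracAct s)),
    fun s => (I₁ s, .op (I₂ s), .op (I₃ s)), ?_⟩
  refine
    { inj := fun a b h => ?_
      map_mul := fun a b => Prod.ext (P.rAct_mul a b) (Prod.ext
        (congrArg MulOpposite.op (P.lAct_mul a b)) (congrArg MulOpposite.op (P.fracAct_mul a b)))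
      inv := fun a => ⟨Prod.ext (h₁ a).1 (Prod.ext (h₂ a).op.1 (h₃ a).op.1),
        Prod.ext (h₁ a).2.1 (Prod.ext (h₂ a).op.2.1 (h₃ a).op.2.1),
        Prod.ext (h₁ a).2.2 (Prod.ext (h₂ a).op.2.2 (h₃ a).op.2.2)⟩
      mul_of_l := fun {b c} h => Prod.ext ?_ (Prod.ext (congrArg MulOpposite.op ?_)
        (congrArg MulOpposite.op ?_))
      mul_of_r := fun {b c} h => Prod.ext ?_ (Prod.ext (congrArg MulOpposite.op ?_)
        (congrArg MulOpposite.op ?_))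
      l_of := fun {b c} h => ?_
      r_of := fun {b c} h => ?_ }
  · have e₁ : P.rAct a = P.rAct b := congrArg Prod.fst h
    have e₂ : P.lAct a = P.lAct b := congrArg (fun t => t.2.1.unop) h
    have e₃ : P.fracAct a = P.fracAct b := congrArg (fun t => t.2.2.unop) h
    have r : ∀ x, Rp ler (a * x) (b * x) := fun x =>
      Quotient.exact (congrFun e₁ (Quotient.mk P.rSetoid x))
    have hab : ler a b := P.r_trans (P.r_sq a) (P.r_trans (r a).1 (P.r_mul_right b a))
    have hba : ler b a := P.r_trans (P.r_sq b) (P.r_trans (r b).2 (P.r_mul_right a b))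
    obtain ⟨-, h⟩ := Quotient.exact
      (congrFun e₃ (Quotient.mk P.fracSetoid ⟨(a, a), P.r_refl a⟩))
    obtain ⟨-, x, y, hx, hy, h₁, h₂⟩ := h (P.r_sq a)
    have ha : ler a (y * a) := P.r_trans hy.2 (P.jBelow_of_r hy.1)
    refine P.mul_left_cancel ha (P.r_trans hba ha) ?_
    rw [← h₁, mul_assoc, mul_assoc]
    exact h₂
  · refine (h₁ c).end_mul_mul_of_ker fun p q hpq => ?_
    induction p using Quotient.inductionOn with | _ x
    induction q using Quotient.inductionOn with | _ y
    exact Quotient.sound (P.rp_mul_of_rp_mul h (Quotient.exact hpq))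
  · refine (mul_assoc _ _ _).trans ((h₂ c).end_mul_mul_of_range fun p => ?_)
    induction p using Quotient.inductionOn with | _ x
    exact P.exists_lAct_eq (P.l_trans (P.l_mul_left x b) h)
  · refine (mul_assoc _ _ _).trans ((h₃ c).end_mul_mul_of_range fun p => ?_)
    induction p using Quotient.inductionOn with | _ x
    exact P.exists_fracAct_eq _ (P.l_trans (P.l_mul_left x.1.2 b) h)
  · refine (h₁ c).end_mul_mul_of_range fun p => ?_
    induction p using Quotient.inductionOn with | _ x
    exact P.exists_rAct_eq (P.r_trans (P.r_mul_right b x) h)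
  · refine (mul_assoc _ _ _).trans ((h₂ c).end_mul_mul_of_ker fun p q hpq => ?_)
    induction p using Quotient.inductionOn with | _ x
    induction q using Quotient.inductionOn with | _ y
    exact Quotient.sound (P.lp_mul_of_lp_mul h (Quotient.exact hpq))
  · exact (mul_assoc _ _ _).trans ((h₃ c).end_mul_mul_of_ker (P.fracAct_eq_of_r h))
  · rcases h with h | ⟨t, h⟩
    · have e : P.lAct b = P.lAct c := congrArg (fun t => t.2.1.unop) h
      have l : Lp lel (b * b) (b * c) :=
        Quotient.exact (congrFun e (Quotient.mk P.lSetoid b))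
      exact P.l_trans (P.l_sq b) (P.l_trans l.1 (P.l_mul_left b c))
    · have e : P.lAct b = P.lAct c * t.2.1.unop := congrArg (fun t => t.2.1.unop) h
      obtain ⟨x, hx⟩ := Quotient.exists_rep (t.2.1.unop (Quotient.mk P.lSetoid b))
      have e' : P.lAct b (Quotient.mk P.lSetoid b) = P.lAct c (Quotient.mk P.lSetoid x) := by
        rw [e, hx]
        rfl
      have l : Lp lel (b * b) (x * c) := Quotient.exact e'
      exact P.l_trans (P.l_sq b) (P.l_trans l.1 (P.l_mul_left x c))
  · rcases h with h | ⟨t, h⟩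
    · have e : P.rAct b = P.rAct c := congrArg Prod.fst h
      have r : Rp ler (b * b) (c * b) :=
        Quotient.exact (congrFun e (Quotient.mk P.rSetoid b))
      exact P.r_trans (P.r_sq b) (P.r_trans r.1 (P.r_mul_right c b))
    · have e : P.rAct b = P.rAct c * t.1 := congrArg Prod.fst h
      obtain ⟨x, hx⟩ := Quotient.exists_rep (t.1 (Quotient.mk P.rSetoid b))
      have e' : P.rAct b (Quotient.mk P.rSetoid b) = P.rAct c (Quotient.mk P.rSetoid x) := by
        rw [e, hx]
        rfl
      have r : Rp ler (b * b) (c * x) := Quotient.exact e'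
      exact P.r_trans (P.r_sq b) (P.r_trans r.1 (P.r_mul_right c x))

end IsRegularStarPair

/-- Corollary 5.2: let `S` be a semigroup having an embeddable `*`-pair `(lel, ler)`.
Then there is a completely regular semigroup `Q` containing `S` as a subsemigroup such
that `S` is a straight left order in `Q` and `Q` induces `(lel, ler)`, if and only if
`(lel, ler)` satisfies (GI) and (Gii). -/
theorem straight_left_order_completely_regular_iff {S : Type u} [Semigroup S]
    (lel ler : S → S → Prop) (hemb : IsEmbeddableStarPair lel ler) :
    (∃ (Q : Type u) (iQ : Semigroup Q) (f : S → Q),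
      @CompletelyRegular Q iQ ∧ @StraightLeftOrderExtension S _ lel ler Q iQ f) ↔
    (CondGI lel ler ∧ CondGii lel ler) := by
  constructor
  · rintro ⟨Q, iQ, f, hQ, hf⟩
    exact ⟨condGI_of_extension hQ hf, condGii_of_extension hQ hf⟩
  · rintro ⟨hI, hii⟩
    have P := hemb.isRegularStarPair hI hii
    obtain ⟨T, _, f, I, F⟩ := P.exists_isInvertingMap
    exact ⟨F.quotients P, inferInstance, _, F.completelyRegular_quotients P,
      F.straightLeftOrderExtension_quotients P⟩
end

section
/- Let S be a straight left order in a semigroup Q inducing the embeddable *-pair P = (≤_l, ≤_r) for S. Then the following conditions are equivalent: (i) Q is completely semisimple; (ii) for all a,b ∈ S, a J' ab implies a R' ab, and a J' ba implies a L' ba; (iii) P satisfies M*_r and M*_l. -/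
universe u

variable {Q : Type u}

/-- `x ≤_J y` in a semigroup `Q`: `x ∈ Q¹yQ¹`, i.e. `x ∈ J(y)`. -/
def leJ [Semigroup Q] (x y : Q) : Prop :=
  x = y ∨ (∃ u, x = u * y) ∨ (∃ v, x = y * v) ∨ (∃ u v, x = u * y * v)

/-- The `J`-class of `a`. -/
def JClass [Semigroup Q] (a : Q) : Set Q := { x | leJ x a ∧ leJ a x }

/-- The principal factor of `a`, realised uniformly as the Rees quotient `J(a)/I(a)`
(where `J(a) = Q¹aQ¹` and `I(a) = { s ∈ J(a) : J(s) ⊊ J(a) }`): its nonzero elements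
are the elements of the `J`-class of `a` and `none` is the zero; the product of two
elements of the `J`-class is their product in `Q` if that stays in the `J`-class, and
zero otherwise.  (When `I(a) = ∅` the classical principal factor is the kernel `J(a)`
itself, which is completely simple iff the present semigroup-with-zero is completely
`0`-simple.) -/
abbrev PrincipalFactor [Semigroup Q] (a : Q) := Option (JClass a)

open Classical in
noncomputable instance PrincipalFactor.instMul [Semigroup Q] (a : Q) : Mul (PrincipalFactor a) :=
  ⟨fun x y => match x, y with
    | some u, some v =>
        if h : (u : Q) * (v : Q) ∈ JClass a then some ⟨(u : Q) * (v : Q), h⟩ else none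
    | _, _ => none⟩

/-- A multiplicative structure `T` with zero element `z` is completely `0`-simple: it
is `0`-simple (its only ideals are `{z}` and `T`, and its square is not zero) and it
contains a primitive idempotent, i.e. a minimal nonzero idempotent. -/
def CompletelyZeroSimpleAt (T : Type u) [Mul T] (z : T) : Prop :=
  (∃ x y : T, x * y ≠ z) ∧
  (∀ I : Set T, I.Nonempty → (∀ t : T, ∀ i ∈ I, t * i ∈ I ∧ i * t ∈ I) →
    I = {z} ∨ I = Set.univ) ∧
  (∃ e : T, e ≠ z ∧ e * e = e ∧
    ∀ f : T, f ≠ z → f * f = f → e * f = f → f * e = f → f = e)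

/-- `Q` is completely semisimple: every principal factor of `Q` is completely simple or
completely `0`-simple. -/
def CompletelySemisimple (Q : Type u) [Semigroup Q] : Prop :=
  ∀ a : Q, CompletelyZeroSimpleAt (PrincipalFactor a) none

variable {S : Type u}

/-- `D' = L' ∨ R'`, the join of the equivalences `L'` and `R'` (the equivalence
relation generated by their union). -/
def Dp [Semigroup S] (lel ler : S → S → Prop) : S → S → Prop :=
  Relation.EqvGen (fun x y => Lp lel x y ∨ Rp ler x y)

/-- `a ≤_j b` iff `a D' xby` for some `x, y ∈ S`. -/
def lej [Semigroup S] (lel ler : S → S → Prop) (a b : S) : Prop :=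
  ∃ x y : S, Dp lel ler a (x * b * y)

/-- `a J' b` iff `a ≤_j b` and `b ≤_j a`. -/
def Jp [Semigroup S] (lel ler : S → S → Prop) (a b : S) : Prop :=
  lej lel ler a b ∧ lej lel ler b a

/-- Condition `M*_r`: within each `J'`-class, the `R'`-classes satisfy the descending
chain condition with respect to the order induced by `≤_r`: there is no infinite
sequence `a₁, a₂, …` inside a single `J'`-class with `a_{i+1} ≤_r a_i` and not
`a_i R' a_{i+1}` for all `i`. -/
def CondMstarR [Semigroup S] (lel ler : S → S → Prop) : Prop :=
  ¬ ∃ f : ℕ → S, (∀ i j : ℕ, Jp lel ler (f i) (f j)) ∧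
    ∀ i : ℕ, ler (f (i + 1)) (f i) ∧ ¬ Rp ler (f i) (f (i + 1))

/-- Condition `M*_l`, the dual of `M*_r`. -/
def CondMstarL [Semigroup S] (lel ler : S → S → Prop) : Prop :=
  ¬ ∃ f : ℕ → S, (∀ i j : ℕ, Jp lel ler (f i) (f j)) ∧
    ∀ i : ℕ, lel (f (i + 1)) (f i) ∧ ¬ Lp lel (f i) (f (i + 1))

section Semigroup

variable [Semigroup Q] {x y z : Q}

theorem leL.mul_right (h : leL x y) (c : Q) : leL (x * c) (y * c) := by
  rcases h with rfl | ⟨u, rfl⟩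
  · exact Or.inl rfl
  · exact Or.inr ⟨u, mul_assoc u y c⟩

theorem leR.mul_left (h : leR x y) (c : Q) : leR (c * x) (c * y) := by
  rcases h with rfl | ⟨u, rfl⟩
  · exact Or.inl rfl
  · exact Or.inr ⟨u, (mul_assoc c y u).symm⟩

theorem leR.trans (h : leR x y) (h' : leR y z) : leR x z := by
  rcases h with rfl | ⟨u, rfl⟩
  · exact h'
  · rcases h' with rfl | ⟨v, rfl⟩
    · exact Or.inr ⟨u, rfl⟩
    · exact Or.inr ⟨v * u, mul_assoc z v u⟩

theorem leL.trans (h : leL x y) (h' : leL y z) : leL x z := by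
  rcases h with rfl | ⟨u, rfl⟩
  · exact h'
  · rcases h' with rfl | ⟨v, rfl⟩
    · exact Or.inr ⟨u, rfl⟩
    · exact Or.inr ⟨u * v, (mul_assoc u v z).symm⟩

theorem leL.leJ (h : leL x y) : leJ x y := h.imp id Or.inl

theorem leR.leJ (h : leR x y) : leJ x y := h.imp id fun h => Or.inr (Or.inl h)

theorem leJ.trans (h : leJ x y) (h' : leJ y z) : leJ x z := by
  rcases h with rfl | ⟨u, rfl⟩ | ⟨v, rfl⟩ | ⟨u, v, rfl⟩
  · exact h'
  · rcases h' with rfl | ⟨a, rfl⟩ | ⟨b, rfl⟩ | ⟨a, b, rfl⟩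
    · exact Or.inr (Or.inl ⟨u, rfl⟩)
    · exact Or.inr (Or.inl ⟨u * a, by simp only [mul_assoc]⟩)
    · exact Or.inr (Or.inr (Or.inr ⟨u, b, by simp only [mul_assoc]⟩))
    · exact Or.inr (Or.inr (Or.inr ⟨u * a, b, by simp only [mul_assoc]⟩))
  · rcases h' with rfl | ⟨a, rfl⟩ | ⟨b, rfl⟩ | ⟨a, b, rfl⟩
    · exact Or.inr (Or.inr (Or.inl ⟨v, rfl⟩))
    · exact Or.inr (Or.inr (Or.inr ⟨a, v, by simp only [mul_assoc]⟩))
    · exact Or.inr (Or.inr (Or.inl ⟨b * v, by simp only [mul_assoc]⟩))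
    · exact Or.inr (Or.inr (Or.inr ⟨a, b * v, by simp only [mul_assoc]⟩))
  · rcases h' with rfl | ⟨a, rfl⟩ | ⟨b, rfl⟩ | ⟨a, b, rfl⟩
    · exact Or.inr (Or.inr (Or.inr ⟨u, v, rfl⟩))
    · exact Or.inr (Or.inr (Or.inr ⟨u * a, v, by simp only [mul_assoc]⟩))
    · exact Or.inr (Or.inr (Or.inr ⟨u, b * v, by simp only [mul_assoc]⟩))
    · exact Or.inr (Or.inr (Or.inr ⟨u * a, b * v, by simp only [mul_assoc]⟩))

theorem leJ_mul_left (u y : Q) : leJ (u * y) y := Or.inr (Or.inl ⟨u, rfl⟩)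

theorem leJ_mul_right (y v : Q) : leJ (y * v) y := Or.inr (Or.inr (Or.inl ⟨v, rfl⟩))

theorem Regular.leJ_iff (hQ : Regular Q) : leJ x y ↔ ∃ u v, x = u * y * v := by
  refine ⟨?_, fun h => Or.inr (Or.inr (Or.inr h))⟩
  obtain ⟨s, hs⟩ := hQ y
  rintro (rfl | ⟨u, rfl⟩ | ⟨v, rfl⟩ | h)
  · exact ⟨x * s, s * x, by rw [hs, ← mul_assoc, hs]⟩
  · exact ⟨u, s * y, by rw [mul_assoc, ← mul_assoc y, hs]⟩
  · exact ⟨y * s, v, by rw [hs]⟩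
  · exact h

/-- `q J qp` implies `q R qp`. -/
def RightStable (Q : Type u) [Semigroup Q] : Prop :=
  ∀ q p : Q, leJ q (q * p) → leR q (q * p)

/-- `q J pq` implies `q L pq`. -/
def LeftStable (Q : Type u) [Semigroup Q] : Prop :=
  ∀ q p : Q, leJ q (p * q) → leL q (p * q)

/-- Every `J`-class contains an idempotent that is minimal among the idempotents of the class. -/
def HasPrimitiveIdempotents (Q : Type u) [Semigroup Q] : Prop :=
  ∀ q : Q, ∃ e, leJ q e ∧ leJ e q ∧ e * e = e ∧
    ∀ f, leJ e f → f * f = f → e * f = f → f * e = f → f = e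

theorem rightStable_of_forall_mem {T : Set Q} (hL : ∀ q, ∃ t ∈ T, GreenL q t)
    (hR : ∀ q, ∃ t ∈ T, GreenR q t)
    (h : ∀ a ∈ T, ∀ b ∈ T, leJ a (a * b) → leR a (a * b)) : RightStable Q := by
  intro q p hqp
  obtain ⟨b, hb, hqb, hbq⟩ := hL q
  obtain ⟨c, hc, hpc, hcp⟩ := hR p
  have hJ : leJ b (b * c) :=
    ((hbq.leJ.trans hqp).trans (hqb.mul_right p).leJ).trans (hpc.mul_left b).leJ
  have hbp : leR b (b * p) := (h b hb c hc hJ).trans (hcp.mul_left b)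
  rcases hqb with rfl | ⟨s, rfl⟩
  · exact hbp
  · rw [mul_assoc]
    exact hbp.mul_left s

theorem RightStable.not_exists_chain (h : RightStable Q) :
    ¬ ∃ f : ℕ → Q, (∀ i j, leJ (f i) (f j)) ∧
      ∀ i, leR (f (i + 1)) (f i) ∧ ¬ leR (f i) (f (i + 1)) := by
  rintro ⟨f, hJ, hf⟩
  obtain ⟨hle, hnot⟩ := hf 0
  apply hnot
  rcases hle with heq | ⟨x, hx⟩
  · exact Or.inl heq.symm
  · have := hJ 0 (0 + 1)
    rw [hx] at this ⊢
    exact h _ _ this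

theorem Regular.rightStable_of_not_exists_chain (hQ : Regular Q) {T : Set Q}
    (hR : ∀ q, ∃ t ∈ T, GreenR q t)
    (h : ¬ ∃ f : ℕ → Q, (∀ i, f i ∈ T) ∧ (∀ i j, leJ (f i) (f j)) ∧
      ∀ i, leR (f (i + 1)) (f i) ∧ ¬ leR (f i) (f (i + 1))) : RightStable Q := by
  intro q p hqp
  by_contra hn
  obtain ⟨u, v, huv⟩ := hQ.leJ_iff.1 hqp
  let g : ℕ → Q := fun n => Nat.rec q (fun _ x => x * (p * v)) n
  have g_succ (n : ℕ) : g (n + 1) = g n * (p * v) := rfl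
  have u_mul (n : ℕ) : u * g (n + 1) = g n := by
    induction n with
    | zero =>
      change u * (q * (p * v)) = q
      simpa only [mul_assoc] using huv.symm
    | succ n ih => rw [g_succ (n + 1), ← mul_assoc, ih, g_succ]
  have not_leR (n : ℕ) : ¬ leR (g n) (g (n + 1)) := by
    induction n with
    | zero =>
      intro h0
      refine hn (h0.trans (Or.inr ⟨v, ?_⟩))
      exact (mul_assoc q p v).symm
    | succ n ih =>
      intro h0
      have := h0.mul_left u
      rw [u_mul n, u_mul (n + 1)] at this
      exact ih this
  have le_q (n : ℕ) : leJ (g n) q := by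
    induction n with
    | zero => exact Or.inl rfl
    | succ n ih => exact (leJ_mul_right _ _).trans ih
  have q_le (n : ℕ) : leJ q (g n) := by
    induction n with
    | zero => exact Or.inl rfl
    | succ n ih =>
      refine ih.trans ?_
      rw [← u_mul n]
      exact leJ_mul_left _ _
  choose f hfT hgf hfg using fun n => hR (g n)
  refine h ⟨f, hfT, fun i j => ?_, fun i => ⟨?_, fun hi => not_leR i ?_⟩⟩
  · exact (((hfg i).leJ.trans (le_q i)).trans (q_le j)).trans (hgf j).leJ
  · exact ((hfg (i + 1)).trans (Or.inr ⟨p * v, rfl⟩)).trans (hgf i)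
  · exact ((hgf i).trans hi).trans (hfg (i + 1))

theorem Regular.leR_of_primitive (hQ : Regular Q) {e : Q} (he : e * e = e)
    (hprim : ∀ f, leJ e f → f * f = f → e * f = f → f * e = f → f = e)
    (hx : e * x = x) (hex : leJ e x) : leR e x := by
  obtain ⟨u, v, huv⟩ := hQ.leJ_iff.1 hex
  have huv' : e * u * e * x * (v * e) = e := by
    calc e * u * e * x * (v * e) = e * (u * (e * x) * v) * e := by simp only [mul_assoc]
      _ = e := by rw [hx, ← huv, he, he]
  generalize hu' : e * u * e = u' at huv'
  generalize v * e = v' at huv'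
  have heu : e * u' = u' := by rw [← hu', ← mul_assoc, ← mul_assoc, he]
  have hue : u' * e = u' := by rw [← hu', mul_assoc, he]
  have hf : x * v' * u' = e := by
    apply hprim
    · rw [hQ.leJ_iff]
      refine ⟨u', x * v', ?_⟩
      calc e = u' * x * v' * (u' * x * v') := by rw [huv', he]
        _ = _ := by simp only [mul_assoc]
    · calc x * v' * u' * (x * v' * u') = x * v' * (u' * x * v' * u') := by simp only [mul_assoc]
        _ = x * v' * u' := by rw [huv', heu]
    · rw [← mul_assoc, ← mul_assoc, hx]
    · rw [mul_assoc, hue]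
  exact Or.inr ⟨v' * u', by rw [← mul_assoc, hf]⟩

theorem HasPrimitiveIdempotents.rightStable (hQ : Regular Q) (h : HasPrimitiveIdempotents Q) :
    RightStable Q := by
  intro q p hqp
  obtain ⟨e, hqe, heq, he, hprim⟩ := h q
  obtain ⟨s, t, rfl⟩ := hQ.leJ_iff.1 hqe
  have hJ : leJ e (e * (t * p)) := by
    refine (heq.trans hqp).trans ?_
    rw [mul_assoc, mul_assoc]
    exact leJ_mul_left _ _
  have hR : leR e (e * (t * p)) :=
    hQ.leR_of_primitive he hprim (by rw [← mul_assoc, he]) hJ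
  have het : leR (e * t) (e * (t * p)) := leR.trans (Or.inr ⟨t, rfl⟩) hR
  simpa only [mul_assoc] using het.mul_left s

open Classical in
theorem PrincipalFactor.some_mul_some_eq_some_iff {a : Q} {s t r : JClass a} :
    (some s * some t : PrincipalFactor a) = some r ↔ (s : Q) * t = r := by
  change (if h : (s : Q) * (t : Q) ∈ JClass a then some ⟨(s : Q) * (t : Q), h⟩ else none) =
    some r ↔ _
  split_ifs with hm
  · rw [Option.some_inj, Subtype.ext_iff]
  · exact iff_of_false not_false fun h => hm (h ▸ r.2)

theorem PrincipalFactor.none_mul {a : Q} (t : PrincipalFactor a) :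
    (none : PrincipalFactor a) * t = none := rfl

theorem CompletelySemisimple.hasPrimitiveIdempotents (h : CompletelySemisimple Q) :
    HasPrimitiveIdempotents Q := by
  intro q
  obtain ⟨-, -, e, hne, he, hprim⟩ := h q
  obtain ⟨⟨e, heq, hqe⟩, rfl⟩ := Option.ne_none_iff_exists'.1 hne
  refine ⟨e, hqe, heq, PrincipalFactor.some_mul_some_eq_some_iff.1 he, fun f hef hf h1 h2 => ?_⟩
  have hfe : leJ f e := by
    rw [← h1]
    exact leJ_mul_right _ _
  have := hprim (some ⟨f, hfe.trans heq, hqe.trans hef⟩) (Option.some_ne_none _)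
    (PrincipalFactor.some_mul_some_eq_some_iff.2 hf)
    (PrincipalFactor.some_mul_some_eq_some_iff.2 h1)
    (PrincipalFactor.some_mul_some_eq_some_iff.2 h2)
  exact congrArg Subtype.val (Option.some_injective _ this)

theorem RightStable.completelySemisimple (hQ : Regular Q) (h : RightStable Q) :
    CompletelySemisimple Q := by
  intro a
  obtain ⟨s, hs⟩ := hQ a
  have hee : a * s * (a * s) = a * s := by rw [← mul_assoc, hs]
  have hae : leJ a (a * s) := Or.inr (Or.inr (Or.inl ⟨a, hs.symm⟩))
  let e : JClass a := ⟨a * s, leJ_mul_right _ _, hae⟩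
  have he : (some e * some e : PrincipalFactor a) = some e :=
    PrincipalFactor.some_mul_some_eq_some_iff.2 hee
  refine ⟨⟨some e, some e, ?_⟩, fun I hI hideal => ?_, some e, Option.some_ne_none _, he, ?_⟩
  · rw [he]
    exact Option.some_ne_none _
  · by_cases hx : ∃ x : JClass a, some x ∈ I
    · right
      obtain ⟨x, hx⟩ := hx
      refine Set.eq_univ_of_forall fun y => ?_
      cases y with
      | none => exact PrincipalFactor.none_mul (some x) ▸ (hideal none _ hx).1
      | some y =>
        obtain ⟨x, hxa, hax⟩ := x
        obtain ⟨y, hya, hay⟩ := y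
        obtain ⟨t, ht⟩ := hQ x
        obtain ⟨u, v, rfl⟩ := hQ.leJ_iff.1 (hya.trans hax)
        have h1 : u * x * t * x = u * x := by
          rw [mul_assoc, mul_assoc, ← mul_assoc x, ht]
        have h2 : u * x * (t * x * v) = u * x * v := by
          calc u * x * (t * x * v) = u * (x * t * x) * v := by simp only [mul_assoc]
            _ = u * x * v := by rw [ht]
        have hux : leJ a (u * x) := hay.trans (leJ_mul_right _ _)
        let l : JClass a := ⟨u * x * t,
          ((leJ_mul_right _ _).trans (leJ_mul_left _ _)).trans hxa,
          hux.trans (by nth_rw 1 [← h1]; exact leJ_mul_right _ _)⟩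
        let m : JClass a := ⟨u * x, (leJ_mul_left _ _).trans hxa, hux⟩
        let r : JClass a := ⟨t * x * v,
          ((leJ_mul_right _ _).trans (leJ_mul_left _ _)).trans hxa,
          hay.trans (by nth_rw 1 [← h2]; exact leJ_mul_left _ _)⟩
        have hm : some m ∈ I := by
          have := (hideal (some l) _ hx).1
          rwa [PrincipalFactor.some_mul_some_eq_some_iff (r := m) |>.2 h1] at this
        have := (hideal (some r) _ hm).2
        rwa [PrincipalFactor.some_mul_some_eq_some_iff (r := ⟨_, hya, hay⟩) |>.2 h2] at this
    · left
      refine Set.eq_singleton_iff_nonempty_unique_mem.2 ⟨hI, fun x hxI => ?_⟩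
      cases x with
      | none => rfl
      | some x => exact absurd ⟨x, hxI⟩ hx
  · intro f hne hff hef hfe
    obtain ⟨⟨f, hfa, haf⟩, rfl⟩ := Option.ne_none_iff_exists'.1 hne
    have hef' : a * s * f = f := PrincipalFactor.some_mul_some_eq_some_iff.1 hef
    have hfe' : f * (a * s) = f := PrincipalFactor.some_mul_some_eq_some_iff.1 hfe
    have hff' : f * f = f := PrincipalFactor.some_mul_some_eq_some_iff.1 hff
    have hJ : leJ (a * s) (a * s * f) := by
      rw [hef']
      exact (leJ_mul_right _ _).trans haf
    have hR := h _ _ hJ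
    rw [hef'] at hR
    refine congrArg some (Subtype.ext ?_)
    change f = a * s
    rcases hR with heq | ⟨w, hw⟩
    · exact heq.symm
    · calc f = f * (a * s) := hfe'.symm
        _ = a * s := by rw [hw, ← mul_assoc, hff']

end Semigroup

section Opposite

open MulOpposite

variable [Semigroup Q] {x y : Q}

theorem leR_op_iff : leR (op x) (op y) ↔ leL x y := by
  simp only [leR, leL, MulOpposite.exists, ← op_mul, op_inj]

theorem leL_op_iff : leL (op x) (op y) ↔ leR x y := by
  simp only [leR, leL, MulOpposite.exists, ← op_mul, op_inj]

theorem leJ_op_iff : leJ (op x) (op y) ↔ leJ x y := by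
  simp only [leJ, MulOpposite.exists, ← op_mul, op_inj, mul_assoc]
  rw [exists_comm (p := fun u v : Q => x = v * (y * u))]
  tauto

theorem Regular.mulOpposite (hQ : Regular Q) : Regular Qᵐᵒᵖ := by
  intro q
  obtain ⟨x, hx⟩ := hQ q.unop
  refine ⟨op x, unop_injective ?_⟩
  simpa only [unop_mul, unop_op, mul_assoc] using hx

theorem rightStable_mulOpposite_iff : RightStable Qᵐᵒᵖ ↔ LeftStable Q := by
  simp only [RightStable, LeftStable, MulOpposite.forall, ← op_mul, leJ_op_iff, leR_op_iff]

theorem leftStable_of_forall_mem {T : Set Q} (hL : ∀ q, ∃ t ∈ T, GreenL q t)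
    (hR : ∀ q, ∃ t ∈ T, GreenR q t)
    (h : ∀ a ∈ T, ∀ b ∈ T, leJ a (b * a) → leL a (b * a)) : LeftStable Q := by
  rw [← rightStable_mulOpposite_iff]
  apply rightStable_of_forall_mem (T := unop ⁻¹' T)
  · intro q
    obtain ⟨t, ht, h1, h2⟩ := hR q.unop
    exact ⟨op t, ht, leL_op_iff.2 h1, leL_op_iff.2 h2⟩
  · intro q
    obtain ⟨t, ht, h1, h2⟩ := hL q.unop
    exact ⟨op t, ht, leR_op_iff.2 h1, leR_op_iff.2 h2⟩
  · intro a ha b hb hJ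
    exact leR_op_iff.2 (h a.unop ha b.unop hb (leJ_op_iff.1 hJ))

theorem LeftStable.not_exists_chain (h : LeftStable Q) :
    ¬ ∃ f : ℕ → Q, (∀ i j, leJ (f i) (f j)) ∧
      ∀ i, leL (f (i + 1)) (f i) ∧ ¬ leL (f i) (f (i + 1)) := by
  rintro ⟨f, hJ, hf⟩
  refine (rightStable_mulOpposite_iff.2 h).not_exists_chain
    ⟨fun i => op (f i), fun i j => leJ_op_iff.2 (hJ i j), fun i => ?_⟩
  rw [leR_op_iff, leR_op_iff]
  exact hf i

theorem Regular.leftStable_of_not_exists_chain (hQ : Regular Q) {T : Set Q}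
    (hL : ∀ q, ∃ t ∈ T, GreenL q t)
    (h : ¬ ∃ f : ℕ → Q, (∀ i, f i ∈ T) ∧ (∀ i j, leJ (f i) (f j)) ∧
      ∀ i, leL (f (i + 1)) (f i) ∧ ¬ leL (f i) (f (i + 1))) : LeftStable Q := by
  rw [← rightStable_mulOpposite_iff]
  apply hQ.mulOpposite.rightStable_of_not_exists_chain (T := unop ⁻¹' T)
  · intro q
    obtain ⟨t, ht, h1, h2⟩ := hL q.unop
    exact ⟨op t, ht, leR_op_iff.2 h1, leR_op_iff.2 h2⟩
  · rintro ⟨f, hfT, hJ, hf⟩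
    exact h ⟨fun i => (f i).unop, hfT, fun i j => leJ_op_iff.1 (hJ i j),
      fun i => ⟨leR_op_iff.1 (hf i).1, fun hi => (hf i).2 (leR_op_iff.2 hi)⟩⟩

theorem HasPrimitiveIdempotents.mulOpposite (h : HasPrimitiveIdempotents Q) :
    HasPrimitiveIdempotents Qᵐᵒᵖ := by
  intro q
  obtain ⟨e, hqe, heq, he, hprim⟩ := h q.unop
  refine ⟨op e, leJ_op_iff.2 hqe, leJ_op_iff.2 heq, congrArg op he, fun f hef hf h1 h2 => ?_⟩
  exact unop_injective (hprim f.unop (leJ_op_iff.1 hef) (congrArg unop hf)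
    (congrArg unop h2) (congrArg unop h1))

theorem HasPrimitiveIdempotents.leftStable (hQ : Regular Q) (h : HasPrimitiveIdempotents Q) :
    LeftStable Q :=
  rightStable_mulOpposite_iff.1 (h.mulOpposite.rightStable hQ.mulOpposite)

end Opposite

/-- A quotient `c * b` of `R`-related elements, `c` being the group inverse of `a`, is `L`-related
to the numerator `b` and `R`-related to the denominator `a`. -/
theorem IsGroupInverse.greenL_and_greenR [Semigroup Q] {a b c : Q} (h : IsGroupInverse a c)
    (hab : GreenR a b) : GreenL (c * b) b ∧ GreenR (c * b) a := by
  obtain ⟨hcomm, haca, hcac⟩ := h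
  have hb : a * (c * b) = b := by
    rcases hab.2 with rfl | ⟨x, rfl⟩
    · rw [← mul_assoc, haca]
    · rw [← mul_assoc, ← mul_assoc, haca]
  have hca : GreenR (c * a) a := by
    rw [← hcomm]
    exact ⟨Or.inr ⟨c, rfl⟩, Or.inr ⟨a, haca.symm⟩⟩
  exact ⟨⟨Or.inr ⟨c, rfl⟩, Or.inr ⟨a, hb.symm⟩⟩,
    (hab.2.mul_left c).trans hca.1, hca.2.trans (hab.1.mul_left c)⟩

theorem regular_of_greenR_inSubgroup [Semigroup Q]
    (h : ∀ q : Q, ∃ a, inSubgroup a ∧ GreenR q a) : Regular Q := by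
  intro q
  obtain ⟨a, ⟨c, -, haca, -⟩, hqa, haq⟩ := h q
  have hq : a * c * q = q := by
    rcases hqa with rfl | ⟨x, rfl⟩
    · exact haca
    · rw [← mul_assoc, haca]
  rcases haq with rfl | ⟨x, rfl⟩
  · exact ⟨c, haca⟩
  · exact ⟨x * c, by rw [← mul_assoc, hq]⟩

section InducedPair

variable [Semigroup Q] {S : Subsemigroup Q} {lel ler : ↥S → ↥S → Prop}
  (hlel : ∀ b c : ↥S, lel b c ↔ leL (b : Q) c) (hler : ∀ b c : ↥S, ler b c ↔ leR (b : Q) c)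
include hlel hler

theorem Dp.leJ {a b : ↥S} (h : Dp lel ler a b) : leJ (a : Q) b ∧ leJ (b : Q) a := by
  induction h with
  | rel x y h =>
    rcases h with h | h
    · exact ⟨((hlel _ _).1 h.1).leJ, ((hlel _ _).1 h.2).leJ⟩
    · exact ⟨((hler _ _).1 h.1).leJ, ((hler _ _).1 h.2).leJ⟩
  | refl x => exact ⟨Or.inl rfl, Or.inl rfl⟩
  | symm x y _ ih => exact ih.symm
  | trans x y z _ _ ih₁ ih₂ => exact ⟨ih₁.1.trans ih₂.1, ih₂.2.trans ih₁.2⟩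

theorem lej_iff_leJ (hQ : Regular Q)
    (hLR : ∀ q : Q, ∃ l ∈ S, ∃ r ∈ S, GreenL q l ∧ GreenR q r ∧ GreenR r l) {a b : ↥S} :
    lej lel ler a b ↔ leJ (a : Q) b := by
  constructor
  · rintro ⟨x, y, h⟩
    exact (h.leJ hlel hler).1.trans ((leJ_mul_right _ _).trans (leJ_mul_left _ _))
  · intro h
    obtain ⟨u, v, huv⟩ := hQ.leJ_iff.1 h
    obtain ⟨x, hx, -, -, hux, -, -⟩ := hLR u
    obtain ⟨-, -, y, hy, -, hvy, -⟩ := hLR v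
    have h1 : GreenL (a : Q) (x * b * v) := by
      rw [huv]
      exact ⟨(hux.1.mul_right b).mul_right v, (hux.2.mul_right b).mul_right v⟩
    have h2 : GreenR (x * b * v) (x * b * y) := ⟨hvy.1.mul_left _, hvy.2.mul_left _⟩
    obtain ⟨l, hl, r, hr, hml, hmr, hrl⟩ := hLR (x * b * v)
    refine ⟨⟨x, hx⟩, ⟨y, hy⟩, .trans _ ⟨l, hl⟩ _ (.rel _ _ (Or.inl ⟨?_, ?_⟩))
      (.rel _ _ (Or.inr ⟨?_, ?_⟩))⟩
    · exact (hlel _ _).2 (h1.1.trans hml.1)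
    · exact (hlel _ _).2 (hml.2.trans h1.2)
    · exact (hler _ _).2 ((hrl.2.trans hmr.2).trans h2.1)
    · exact (hler _ _).2 ((h2.2.trans hmr.1).trans hrl.1)

end InducedPair

/-- Theorem 5.7: let `S` be a straight left order in a semigroup `Q` inducing the
embeddable `*`-pair `(lel, ler)` for `S`.  Then the following are equivalent:
(i) `Q` is completely semisimple;
(ii) for all `a, b ∈ S`, `a J' ab` implies `a R' ab`, and `a J' ba` implies `a L' ba`;
(iii) `(lel, ler)` satisfies `M*_r` and `M*_l`. -/
theorem completely_semisimple_tfae {Q : Type u} [Semigroup Q] (S : Subsemigroup Q)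
    (lel ler : ↥S → ↥S → Prop)
    (hemb : IsEmbeddableStarPair lel ler)
    (hslo : ∀ q : Q, ∃ a b : ↥S, (∃ c, IsGroupInverse (a : Q) c ∧ q = c * (b : Q)) ∧
      GreenR (a : Q) (b : Q))
    (hsq : ∀ a : ↥S, SqC a → inSubgroup (a : Q))
    (hind : ∀ b c : ↥S,
      (lel b c ↔ leL (b : Q) (c : Q)) ∧ (ler b c ↔ leR (b : Q) (c : Q))) :
    (CompletelySemisimple Q ↔
      (∀ a b : ↥S, (Jp lel ler a (a * b) → Rp ler a (a * b)) ∧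
        (Jp lel ler a (b * a) → Lp lel a (b * a)))) ∧
    ((∀ a b : ↥S, (Jp lel ler a (a * b) → Rp ler a (a * b)) ∧
        (Jp lel ler a (b * a) → Lp lel a (b * a))) ↔
      (CondMstarR lel ler ∧ CondMstarL lel ler)) := by
  have hlel (b c : ↥S) := (hind b c).1
  have hler (b c : ↥S) := (hind b c).2
  have hLR (q : Q) : ∃ l ∈ S, ∃ r ∈ S, GreenL q l ∧ GreenR q r ∧ GreenR r l := by
    obtain ⟨a, b, ⟨c, hc, rfl⟩, hab⟩ := hslo q
    obtain ⟨h1, h2⟩ := hc.greenL_and_greenR hab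
    exact ⟨b, b.2, a, a.2, h1, h2, hab⟩
  have hL (q : Q) : ∃ t ∈ S, GreenL q t := by
    obtain ⟨l, hl, -, -, h, -⟩ := hLR q
    exact ⟨l, hl, h⟩
  have hR (q : Q) : ∃ t ∈ S, GreenR q t := by
    obtain ⟨-, -, r, hr, -, h, -⟩ := hLR q
    exact ⟨r, hr, h⟩
  have hQ : Regular Q := regular_of_greenR_inSubgroup fun q => by
    obtain ⟨a, b, ⟨c, hc, rfl⟩, hab⟩ := hslo q
    exact ⟨a, ⟨c, hc⟩, (hc.greenL_and_greenR hab).2⟩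
  have hJ (a b : ↥S) : Jp lel ler a b ↔ leJ (a : Q) b ∧ leJ (b : Q) a :=
    and_congr (lej_iff_leJ hlel hler hQ hLR) (lej_iff_leJ hlel hler hQ hLR)
  have hstable : (∀ a b : ↥S, (Jp lel ler a (a * b) → Rp ler a (a * b)) ∧
      (Jp lel ler a (b * a) → Lp lel a (b * a))) ↔ RightStable Q ∧ LeftStable Q := by
    constructor
    · intro h
      constructor
      · refine rightStable_of_forall_mem (T := S) hL hR fun a ha b hb hab => ?_
        exact (hler _ _).1 ((h ⟨a, ha⟩ ⟨b, hb⟩).1 ((hJ _ _).2 ⟨hab, leJ_mul_right _ _⟩)).1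
      · refine leftStable_of_forall_mem (T := S) hL hR fun a ha b hb hab => ?_
        exact (hlel _ _).1 ((h ⟨a, ha⟩ ⟨b, hb⟩).2 ((hJ _ _).2 ⟨hab, leJ_mul_left _ _⟩)).1
    · rintro ⟨hr, hl⟩ a b
      exact ⟨fun h => ⟨(hler _ _).2 (hr _ _ ((hJ _ _).1 h).1), (hler _ _).2 (Or.inr ⟨b, rfl⟩)⟩,
        fun h => ⟨(hlel _ _).2 (hl _ _ ((hJ _ _).1 h).1), (hlel _ _).2 (Or.inr ⟨b, rfl⟩)⟩⟩
  have hMr : CondMstarR lel ler ↔ RightStable Q := by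
    constructor
    · intro h
      refine hQ.rightStable_of_not_exists_chain (T := S) hR ?_
      rintro ⟨f, hf, hfJ, hfR⟩
      exact h ⟨fun i => ⟨f i, hf i⟩, fun i j => (hJ _ _).2 ⟨hfJ i j, hfJ j i⟩,
        fun i => ⟨(hler _ _).2 (hfR i).1, fun hi => (hfR i).2 ((hler _ _).1 hi.1)⟩⟩
    · rintro h ⟨f, hfJ, hfR⟩
      exact h.not_exists_chain ⟨fun i => f i, fun i j => ((hJ _ _).1 (hfJ i j)).1,
        fun i => ⟨(hler _ _).1 (hfR i).1, fun hi => (hfR i).2 ⟨(hler _ _).2 hi, (hfR i).1⟩⟩⟩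
  have hMl : CondMstarL lel ler ↔ LeftStable Q := by
    constructor
    · intro h
      refine hQ.leftStable_of_not_exists_chain (T := S) hL ?_
      rintro ⟨f, hf, hfJ, hfL⟩
      exact h ⟨fun i => ⟨f i, hf i⟩, fun i j => (hJ _ _).2 ⟨hfJ i j, hfJ j i⟩,
        fun i => ⟨(hlel _ _).2 (hfL i).1, fun hi => (hfL i).2 ((hlel _ _).1 hi.1)⟩⟩
    · rintro h ⟨f, hfJ, hfL⟩
      exact h.not_exists_chain ⟨fun i => f i, fun i j => ((hJ _ _).1 (hfJ i j)).1,
        fun i => ⟨(hlel _ _).1 (hfL i).1, fun hi => (hfL i).2 ⟨(hlel _ _).2 hi, (hfL i).1⟩⟩⟩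
  rw [hstable, hMr, hMl]
  refine ⟨⟨fun h => ?_, fun h => h.1.completelySemisimple hQ⟩, Iff.rfl⟩
  have hprim := h.hasPrimitiveIdempotents
  exact ⟨hprim.rightStable hQ, hprim.leftStable hQ⟩
end
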